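/- arXiv:math/0703178 — 2 statements merged into one kernel-verified Lean document; each statement's English description precedes it below -/
import Mathlib

section
/- Let Q be a Dynkin quiver. For each finitely supported function α : Φ_+ → ℕ there exists a monic polynomial a_α ∈ ℤ[T] such that for every finite field k with q elements and every finite-dimensional kQ-module A with [A] = α, one has |Aut(A)| = a_α(q). -/
open Polynomial

/-- A finite quiver, given by a finite set of vertices, a finite set of arrows,
and source/target maps. -/
structure QuiverData where
  V : Type
  A : Type
  [fintV : Fintype V]
  [decV : DecidableEq V]
  [fintA : Fintype A]
  s : A → V
  t : A → V

attribute [instance] QuiverData.fintV QuiverData.decV QuiverData.fintA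

/-- A representation of a quiver over a field `k`:  a finite dimensional vector
space at each vertex together with a linear map for each arrow.  This is the same
thing as a `kQ`-module (finite dimensionality is imposed separately via `FinDim`). -/
structure Repn (k : Type) [Field k] (Q : QuiverData) where
  space : Q.V → Type
  [addcg : ∀ v, AddCommGroup (space v)]
  [mod : ∀ v, Module k (space v)]
  map : ∀ a : Q.A, space (Q.s a) →ₗ[k] space (Q.t a)

attribute [instance] Repn.addcg Repn.mod

namespace Repn

variable {k : Type} [Field k] {Q : QuiverData}

/-- An isomorphism of representations. -/
structure Iso (M N : Repn k Q) where
  e : ∀ v, M.space v ≃ₗ[k] N.space v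
  comm : ∀ (a : Q.A) (x : M.space (Q.s a)), e (Q.t a) (M.map a x) = N.map a (e (Q.s a) x)

/-- Direct sum of two representations. -/
def dsum (M N : Repn k Q) : Repn k Q where
  space v := M.space v × N.space v
  map a := (M.map a).prodMap (N.map a)

/-- Direct sum of a family of representations. -/
def dsumFam {ι : Type} (X : ι → Repn k Q) : Repn k Q where
  space v := ∀ i, (X i).space v
  map a := LinearMap.pi fun i => ((X i).map a).comp (LinearMap.proj i)

/-- The zero representation(s). -/
def IsZero (M : Repn k Q) : Prop := ∀ (v : Q.V) (x : M.space v), x = 0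

/-- Pointwise finite dimensionality, i.e. `M` is a finite `kQ`-module. -/
def FinDim (M : Repn k Q) : Prop := ∀ v, FiniteDimensional k (M.space v)

/-- Indecomposability. -/
def Indec (M : Repn k Q) : Prop :=
  ¬ M.IsZero ∧ ∀ Y Z : Repn k Q, Nonempty (Iso M (Y.dsum Z)) → Y.IsZero ∨ Z.IsZero

/-- The dimension vector. -/
noncomputable def dimv (M : Repn k Q) : Q.V → ℕ := fun v => Module.finrank k (M.space v)

end Repn

/-- A subrepresentation of `X`, i.e. a `kQ`-submodule. -/
structure Subrep {k : Type} [Field k] {Q : QuiverData} (X : Repn k Q) where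
  sub : ∀ v, Submodule k (X.space v)
  stable : ∀ a : Q.A, (sub (Q.s a)).map (X.map a) ≤ sub (Q.t a)

namespace Subrep

variable {k : Type} [Field k] {Q : QuiverData} {X : Repn k Q}

/-- A subrepresentation as a representation. -/
def repn (U : Subrep X) : Repn k Q where
  space v := U.sub v
  map a := (X.map a).restrict fun _ hx => U.stable a (Submodule.mem_map_of_mem hx)

/-- The quotient representation `X/U`. -/
def quot (U : Subrep X) : Repn k Q where
  space v := X.space v ⧸ U.sub v
  map a := Submodule.mapQ (U.sub (Q.s a)) (U.sub (Q.t a)) (X.map a)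
    (Submodule.map_le_iff_le_comap.mp (U.stable a))

end Subrep

/-- The Hall number `F_{MN}^X`: the number of subrepresentations `U ≤ X` with
`U ≅ N` and `X/U ≅ M`. -/
noncomputable def hallNum {k : Type} [Field k] {Q : QuiverData} (M N X : Repn k Q) : ℕ :=
  Nat.card {U : Subrep X // Nonempty (Repn.Iso U.repn N) ∧ Nonempty (Repn.Iso U.quot M)}

/-- The number of automorphisms of a representation. -/
noncomputable def autCard {k : Type} [Field k] {Q : QuiverData} (M : Repn k Q) : ℕ :=
  Nat.card (Repn.Iso M M)

/-- The Euler form of the quiver `Q`. -/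
def eulerZ (Q : QuiverData) (d e : Q.V → ℤ) : ℤ :=
  (∑ v, d v * e v) - ∑ a, d (Q.s a) * e (Q.t a)

/-- The Tits quadratic form of `Q`. -/
def titsZ (Q : QuiverData) (d : Q.V → ℤ) : ℤ := eulerZ Q d d

/-- Coercion of a dimension vector to an integral vector. -/
def natc {Q : QuiverData} (d : Q.V → ℕ) : Q.V → ℤ := fun v => (d v : ℤ)

/-- Connectedness of the underlying graph of `Q`. -/
def QuiverData.Connected (Q : QuiverData) : Prop :=
  ∀ u v : Q.V, Relation.ReflTransGen
    (fun x y => ∃ a, (Q.s a = x ∧ Q.t a = y) ∨ (Q.s a = y ∧ Q.t a = x)) u v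

/-- `Q` is a Dynkin quiver iff it is connected and its Tits form is positive definite. -/
def IsDynkin (Q : QuiverData) : Prop :=
  Q.Connected ∧ ∀ d : Q.V → ℤ, d ≠ 0 → 0 < titsZ Q d

/-- `Q` is an extended Dynkin (affine) quiver iff it is connected and its Tits form is
positive semidefinite but not definite. -/
def IsAffine (Q : QuiverData) : Prop :=
  Q.Connected ∧ (∀ d : Q.V → ℤ, 0 ≤ titsZ Q d) ∧ ∃ d : Q.V → ℤ, d ≠ 0 ∧ titsZ Q d = 0

/-- `δ` is the minimal positive imaginary root of the affine quiver `Q`. -/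
def IsMinImagRoot (Q : QuiverData) (δ : Q.V → ℕ) : Prop :=
  δ ≠ 0 ∧ titsZ Q (natc δ) = 0 ∧
    ∀ d : Q.V → ℕ, d ≠ 0 → titsZ Q (natc d) = 0 → ∀ v, δ v ≤ d v

/-- `Q` is an oriented cycle iff every vertex has exactly one incoming and one
outgoing arrow (`Q` being connected). -/
def IsOrientedCycle (Q : QuiverData) : Prop :=
  ∀ v : Q.V, Nat.card {a : Q.A // Q.s a = v} = 1 ∧ Nat.card {a : Q.A // Q.t a = v} = 1

/-- The standard map whose kernel is `Hom(M,N)` and whose cokernel is `Ext¹(M,N)`. -/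
noncomputable def extMap {k : Type} [Field k] {Q : QuiverData} (M N : Repn k Q) :
    (∀ v, M.space v →ₗ[k] N.space v) →ₗ[k] (∀ a : Q.A, M.space (Q.s a) →ₗ[k] N.space (Q.t a)) :=
  LinearMap.pi fun a =>
    ((LinearMap.llcomp k (M.space (Q.s a)) (N.space (Q.s a)) (N.space (Q.t a)) (N.map a)).comp
        (LinearMap.proj (Q.s a)))
      - ((LinearMap.lcomp k (N.space (Q.t a)) (M.map a)).comp (LinearMap.proj (Q.t a)))

/-- `dim_k Hom(M,N)`. -/
noncomputable def homDim {k : Type} [Field k] {Q : QuiverData} (M N : Repn k Q) : ℕ :=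
  Module.finrank k (LinearMap.ker (extMap M N))

/-- `dim_k Ext¹(M,N)`. -/
noncomputable def extDim {k : Type} [Field k] {Q : QuiverData} (M N : Repn k Q) : ℕ :=
  Module.finrank k
    ((∀ a : Q.A, M.space (Q.s a) →ₗ[k] N.space (Q.t a)) ⧸ LinearMap.range (extMap M N))

/-- A positive root of the Tits form of `Q`. -/
def IsPosRoot (Q : QuiverData) (d : Q.V → ℕ) : Prop := d ≠ 0 ∧ titsZ Q (natc d) = 1

/-- `[M] = μ` for a Dynkin quiver:  by Gabriel's theorem the indecomposables are
classified by their dimension vectors, which are the positive roots; `μ` records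
the multiplicity of each indecomposable (labelled by its dimension vector) in a
decomposition of `M` into indecomposable direct summands. -/
def HasClassDynkin {k : Type} [Field k] {Q : QuiverData}
    (M : Repn k Q) (μ : (Q.V → ℕ) → ℕ) : Prop :=
  ∃ (ι : Type) (_ : Fintype ι) (Xi : ι → Repn k Q) (r : ι → Q.V → ℕ),
    (∀ i, (Xi i).Indec ∧ (Xi i).FinDim ∧ Repn.dimv (Xi i) = r i) ∧
    (∀ d, μ d = Nat.card {i // r i = d}) ∧
    Nonempty (Repn.Iso M (Repn.dsumFam Xi))

namespace DynkinAut

section Basics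

variable {k : Type} [Field k] {Q : QuiverData}

/-- A family of linear maps indexed by the vertices. -/
abbrev Fam (M N : Repn k Q) := ∀ v, M.space v →ₗ[k] N.space v

/-- The family is a morphism of representations. -/
def IsHom {M N : Repn k Q} (f : Fam M N) : Prop :=
  ∀ (a : Q.A) (x : M.space (Q.s a)), f (Q.t a) (M.map a x) = N.map a (f (Q.s a) x)

/-- Composition of families. -/
def comp {L M N : Repn k Q} (g : Fam M N) (f : Fam L M) : Fam L N := fun v => (g v).comp (f v)

@[simp] lemma comp_apply {L M N : Repn k Q} (g : Fam M N) (f : Fam L M) (v : Q.V)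
    (x : L.space v) : comp g f v x = g v (f v x) := rfl

/-- The identity family. -/
def idF (M : Repn k Q) : Fam M M := fun _ => LinearMap.id

@[simp] lemma idF_apply (M : Repn k Q) (v : Q.V) (x : M.space v) : idF M v x = x := rfl

lemma isHom_id (M : Repn k Q) : IsHom (idF M) := fun _ _ => rfl

lemma IsHom.comp {L M N : Repn k Q} {g : Fam M N} {f : Fam L M} (hg : IsHom g) (hf : IsHom f) :
    IsHom (comp g f) := fun a x => by
  simp only [comp_apply]; rw [hf, hg]

lemma extMap_apply {M N : Repn k Q} (f : Fam M N) (a : Q.A) (x : M.space (Q.s a)) :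
    extMap M N f a x = N.map a (f (Q.s a) x) - f (Q.t a) (M.map a x) := rfl

lemma mem_ker_extMap {M N : Repn k Q} (f : Fam M N) :
    f ∈ LinearMap.ker (extMap M N) ↔ IsHom f := by
  rw [LinearMap.mem_ker]
  constructor
  · intro h a x
    have := congrArg (fun g => g a x) h
    simp only [extMap_apply] at this
    exact (sub_eq_zero.mp this).symm
  · intro h
    funext a
    ext x
    rw [extMap_apply, h a x, sub_self]
    rfl

/-- Vanishing of `Ext¹(M,N)`. -/
def Ext0 (M N : Repn k Q) : Prop :=
  ∀ g : (∀ a : Q.A, M.space (Q.s a) →ₗ[k] N.space (Q.t a)),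
    ∃ h : Fam M N, ∀ a x, N.map a (h (Q.s a) x) - h (Q.t a) (M.map a x) = g a x

lemma exists_retr {M N : Repn k Q} (i : Fam M N) (hi : ∀ v, Function.Injective (i v)) :
    ∃ r : Fam N M, ∀ v x, r v (i v x) = x := by
  have : ∀ v, ∃ r : N.space v →ₗ[k] M.space v, r.comp (i v) = LinearMap.id := fun v =>
    LinearMap.exists_leftInverse_of_injective (i v) (LinearMap.ker_eq_bot.mpr (hi v))
  choose r hr using this
  exact ⟨r, fun v x => LinearMap.congr_fun (hr v) x⟩

lemma exists_sect {M N : Repn k Q} (p : Fam M N) (hp : ∀ v, Function.Surjective (p v)) :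
    ∃ r : Fam N M, ∀ v x, p v (r v x) = x := by
  have : ∀ v, ∃ r : N.space v →ₗ[k] M.space v, (p v).comp r = LinearMap.id := fun v =>
    LinearMap.exists_rightInverse_of_surjective (p v) (LinearMap.range_eq_top.mpr (hp v))
  choose r hr using this
  exact ⟨r, fun v x => LinearMap.congr_fun (hr v) x⟩

lemma Ext0.of_mono {I b c : Repn k Q} (i : Fam I b) (hi : IsHom i)
    (inj : ∀ v, Function.Injective (i v)) (h : Ext0 b c) : Ext0 I c := by
  intro g
  obtain ⟨r, hr⟩ := exists_retr i inj
  obtain ⟨h', hh⟩ := h (fun a => (g a).comp (r (Q.s a)))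
  refine ⟨comp h' i, fun a x => ?_⟩
  simp only [comp_apply]
  rw [hi, hh]
  simp [hr]

lemma Ext0.of_epi {c b I : Repn k Q} (p : Fam b I) (hp : IsHom p)
    (sur : ∀ v, Function.Surjective (p v)) (h : Ext0 c b) : Ext0 c I := by
  intro g
  obtain ⟨r, hr⟩ := exists_sect p sur
  obtain ⟨h', hh⟩ := h (fun a => (r (Q.t a)).comp (g a))
  refine ⟨comp p h', fun a x => ?_⟩
  simp only [comp_apply]
  rw [← hp, ← map_sub, hh]
  simp [hr]

lemma Ext0.of_exact {K a I c : Repn k Q} (i : Fam K a) (hi : IsHom i)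
    (inj : ∀ v, Function.Injective (i v)) (p : Fam a I) (hp : IsHom p)
    (sur : ∀ v, Function.Surjective (p v))
    (ex : ∀ v x, p v x = 0 → ∃ y, i v y = x) (hK : Ext0 K c) (hI : Ext0 I c) : Ext0 a c := by
  intro g
  obtain ⟨r, hr⟩ := exists_retr i inj
  obtain ⟨σ, hσ⟩ := exists_sect p sur
  obtain ⟨h, hh⟩ := hK (fun a => (g a).comp (i (Q.s a)))
  obtain ⟨h2, hh2⟩ := hI (fun a => (g a - extMap _ _ (comp h r) a).comp (σ (Q.s a)))
  refine ⟨comp h r + comp h2 p, fun a x => ?_⟩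
  have e1 : (g a - extMap _ _ (comp h r) a) (σ _ (p _ x)) =
      (g a - extMap _ _ (comp h r) a) x := by
    rw [← sub_eq_zero, ← map_sub]
    obtain ⟨y, hy⟩ := ex _ (σ _ (p _ x) - x) (by rw [map_sub, hσ, sub_self])
    rw [← hy, LinearMap.sub_apply, extMap_apply]
    have := hh a y
    simp only [LinearMap.comp_apply] at this
    rw [← this]
    simp only [comp_apply]
    rw [hr, ← hi, hr]
    simp
  have e2 := hh2 a (p _ x)
  rw [LinearMap.comp_apply, e1, LinearMap.sub_apply, extMap_apply] at e2
  simp only [comp_apply] at e2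
  simp only [Pi.add_apply, LinearMap.add_apply, comp_apply, map_add]
  rw [hp, add_sub_add_comm, e2]
  abel

lemma exists_extension {K a I c : Repn k Q} (i : Fam K a) (hi : IsHom i)
    (inj : ∀ v, Function.Injective (i v)) (p : Fam a I) (hp : IsHom p)
    (sur : ∀ v, Function.Surjective (p v))
    (ex : ∀ v x, p v x = 0 → ∃ y, i v y = x) (pi : ∀ v y, p v (i v y) = 0)
    (hI : Ext0 I c) (φ : Fam K c) (hφ : IsHom φ) :
    ∃ ψ : Fam a c, IsHom ψ ∧ ∀ v y, ψ v (i v y) = φ v y := by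
  obtain ⟨r, hr⟩ := exists_retr i inj
  obtain ⟨σ, hσ⟩ := exists_sect p sur
  obtain ⟨h2, hh2⟩ := hI (fun a => (extMap _ _ (comp φ r) a).comp (σ (Q.s a)))
  refine ⟨comp φ r - comp h2 p, fun a x => ?_, fun v y => ?_⟩
  · have e1 : (extMap _ _ (comp φ r) a) (σ _ (p _ x)) = (extMap _ _ (comp φ r) a) x := by
      rw [← sub_eq_zero, ← map_sub]
      obtain ⟨y, hy⟩ := ex _ (σ _ (p _ x) - x) (by rw [map_sub, hσ, sub_self])
      rw [← hy, extMap_apply]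
      simp only [comp_apply]
      rw [hr, ← hi, hr, hφ, sub_self]
    have e2 := hh2 a (p _ x)
    rw [LinearMap.comp_apply, e1, extMap_apply] at e2
    simp only [comp_apply] at e2
    simp only [Pi.sub_apply, LinearMap.sub_apply, comp_apply, map_sub]
    rw [hp, ← sub_eq_zero]
    have := sub_eq_zero.mpr e2
    rw [← this]
    abel
  · simp [hr, pi]

/-- Total dimension. -/
noncomputable def tdim (M : Repn k Q) : ℕ := ∑ v, Module.finrank k (M.space v)

/-- Kernel. -/
def kerS {M N : Repn k Q} (f : Fam M N) (hf : IsHom f) : Subrep M where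
  sub v := LinearMap.ker (f v)
  stable a := by
    rintro _ ⟨x, hx, rfl⟩
    have hx' : f _ x = 0 := hx
    rw [LinearMap.mem_ker, hf, hx', map_zero]

/-- Image. -/
def rangeS {M N : Repn k Q} (f : Fam M N) (hf : IsHom f) : Subrep N where
  sub v := LinearMap.range (f v)
  stable a := by
    rintro _ ⟨_, ⟨x, rfl⟩, rfl⟩
    exact ⟨M.map a x, hf a x⟩

/-- Inclusion. -/
def incl {M : Repn k Q} (U : Subrep M) : Fam U.repn M := fun v => (U.sub v).subtype

lemma isHom_incl {M : Repn k Q} (U : Subrep M) : IsHom (incl U) := fun _ _ => rfl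

lemma incl_inj {M : Repn k Q} (U : Subrep M) (v : Q.V) : Function.Injective (incl U v) :=
  Subtype.val_injective

/-- Corestriction to the image. -/
def toRange {M N : Repn k Q} (f : Fam M N) (hf : IsHom f) : Fam M (rangeS f hf).repn :=
  fun v => (f v).rangeRestrict

lemma incl_toRange {M N : Repn k Q} (f : Fam M N) (hf : IsHom f) (v : Q.V) (x : M.space v) :
    incl (rangeS f hf) v (toRange f hf v x) = f v x := rfl

lemma isHom_toRange {M N : Repn k Q} (f : Fam M N) (hf : IsHom f) : IsHom (toRange f hf) :=
  fun a x => Subtype.ext (hf a x)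

lemma toRange_surj {M N : Repn k Q} (f : Fam M N) (hf : IsHom f) (v : Q.V) :
    Function.Surjective (toRange f hf v) := LinearMap.surjective_rangeRestrict (f v)

lemma finDim_sub {M : Repn k Q} (hM : M.FinDim) (U : Subrep M) : U.repn.FinDim := by
  intro v
  have := hM v
  exact FiniteDimensional.finiteDimensional_submodule (U.sub v)

lemma tdim_lt_of_inj {M N : Repn k Q} (hN : N.FinDim) (i : Fam M N)
    (inj : ∀ v, Function.Injective (i v)) (ns : ∃ v, ¬ Function.Surjective (i v)) :
    tdim M < tdim N := by
  obtain ⟨v, hv⟩ := ns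
  have hle : ∀ v, Module.finrank k (M.space v) ≤ Module.finrank k (N.space v) := fun v => by
    have := hN v
    exact LinearMap.finrank_le_finrank_of_injective (inj v)
  refine Finset.sum_lt_sum (fun v _ => hle v) ⟨v, Finset.mem_univ _, lt_of_le_of_ne (hle v) ?_⟩
  intro h
  have := hN v
  have : FiniteDimensional k (M.space v) := FiniteDimensional.of_injective (i v) (inj v)
  exact hv ((LinearMap.injective_iff_surjective_of_finrank_eq_finrank h).mp (inj v))

/-- `Y ⊕ 0`-type decomposition attached to an idempotent. -/
lemma idem_indec {M : Repn k Q} (hM : M.Indec) (e : Fam M M) (he : IsHom e)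
    (hid : ∀ v x, e v (e v x) = e v x) : (∀ v x, e v x = 0) ∨ (∀ v x, e v x = x) := by
  have key : Nonempty (Repn.Iso M ((rangeS e he).repn.dsum (kerS e he).repn)) := by
    have hk : ∀ v x, x - e v x ∈ LinearMap.ker (e v) := fun v x => by
      rw [LinearMap.mem_ker, map_sub, hid, sub_self]
    refine ⟨⟨fun v => LinearEquiv.ofBijective
      (LinearMap.prod (toRange e he v)
        (LinearMap.codRestrict (LinearMap.ker (e v)) (LinearMap.id - e v) (hk v))) ⟨?_, ?_⟩, ?_⟩⟩
    · rw [injective_iff_map_eq_zero]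
      intro x hx
      have h1 : e v x = 0 := congrArg (fun z => incl (rangeS e he) v z.1) hx
      have h2 : x - e v x = 0 := congrArg (fun z => incl (kerS e he) v z.2) hx
      rw [h1, sub_zero] at h2
      exact h2
    · rintro ⟨⟨_, y, rfl⟩, ⟨z, hz⟩⟩
      have hz' : e v z = 0 := hz
      refine ⟨e v y + z, ?_⟩
      refine Prod.ext (Subtype.ext ?_) (Subtype.ext ?_)
      · show e v (e v y + z) = e v y
        rw [map_add, hid, hz', add_zero]
      · show (e v y + z) - e v (e v y + z) = z
        rw [map_add, hid, hz', add_zero]; abel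
    · intro a x
      refine Prod.ext (Subtype.ext ?_) (Subtype.ext ?_)
      · exact he a x
      · show M.map a x - e _ (M.map a x) = M.map a (x - e _ x)
        rw [map_sub, he]
  rcases hM.2 _ _ key with h | h
  · left
    intro v x
    exact congrArg Subtype.val (h v ⟨e v x, x, rfl⟩)
  · right
    intro v x
    have := congrArg Subtype.val (h v ⟨x - e v x, by
      show x - e v x ∈ LinearMap.ker (e v)
      rw [LinearMap.mem_ker, map_sub, hid, sub_self]⟩)
    exact (sub_eq_zero.mp this).symm

lemma summand_indec {M Y : Repn k Q} (hM : M.Indec) (hY : ¬ Y.IsZero) (i : Fam Y M) (hi : IsHom i)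
    (p : Fam M Y) (hp : IsHom p) (hpi : ∀ v y, p v (i v y) = y) (v : Q.V) (x : M.space v) :
    i v (p v x) = x := by
  rcases idem_indec hM (comp i p) (hi.comp hp) (fun v x => by simp [hpi]) with h | h
  · exfalso
    apply hY
    intro v y
    have := congrArg (p v) (h v (i v y))
    simpa [hpi] using this
  · exact h v x

lemma isZero_of_tdim {M : Repn k Q} (hM : M.FinDim) (h : tdim M = 0) : M.IsZero := by
  intro v x
  have := hM v
  have h0 := (Finset.sum_eq_zero_iff.mp h) v (Finset.mem_univ v)
  have := Module.finrank_zero_iff.mp h0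
  exact Subsingleton.elim _ _

/-- inverse of an isomorphism as a family -/
lemma iso_isHom {M N : Repn k Q} (e : Repn.Iso M N) : IsHom (fun v => (e.e v : M.space v →ₗ[k] N.space v)) :=
  e.comm

lemma iso_symm_isHom {M N : Repn k Q} (e : Repn.Iso M N) :
    IsHom (fun v => ((e.e v).symm : N.space v →ₗ[k] M.space v)) := by
  intro a x
  have := e.comm a ((e.e _).symm x)
  simp only [LinearEquiv.apply_symm_apply] at this
  simp only [LinearEquiv.coe_coe]
  rw [← this, LinearEquiv.symm_apply_apply]

lemma finDim_of_inj {M N : Repn k Q} (hN : N.FinDim) (i : Fam M N)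
    (inj : ∀ v, Function.Injective (i v)) : M.FinDim := fun v => by
  have := hN v
  exact FiniteDimensional.of_injective (i v) (inj v)

lemma exists_indec_summand (K : Repn k Q) (hK : K.FinDim) (P : ∀ K' : Repn k Q, Fam K K' → Prop)
    (h0 : P K (idF K))
    (hs : ∀ (K' Y Z : Repn k Q) (p : Fam K K') (p1 : Fam K' Y) (p2 : Fam K' Z)
      (i1 : Fam Y K') (i2 : Fam Z K'), IsHom p → IsHom p1 → IsHom p2 → IsHom i1 → IsHom i2 →
      (∀ v y, p1 v (i1 v y) = y) → (∀ v y, p2 v (i2 v y) = y) →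
      (∀ v y, p2 v (i1 v y) = 0) → 
      (∀ v x, i1 v (p1 v x) + i2 v (p2 v x) = x) →
      P K' p → P Y (comp p1 p) ∨ P Z (comp p2 p))
    (hnz : ∀ (K' : Repn k Q) (p : Fam K K'), IsHom p → P K' p → ¬ K'.IsZero) :
    ∃ (K' : Repn k Q) (p : Fam K K') (i : Fam K' K), IsHom p ∧ IsHom i ∧
      (∀ v y, p v (i v y) = y) ∧ P K' p ∧ K'.Indec ∧ K'.FinDim := by
  suffices H : ∀ (n : ℕ) (K' : Repn k Q) (p : Fam K K') (i : Fam K' K), tdim K' ≤ n → IsHom p →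
      IsHom i → (∀ v y, p v (i v y) = y) → P K' p → ∃ (K' : Repn k Q) (p : Fam K K')
      (i : Fam K' K), IsHom p ∧ IsHom i ∧
      (∀ v y, p v (i v y) = y) ∧ P K' p ∧ K'.Indec ∧ K'.FinDim from
    H _ K (idF K) (idF K) le_rfl (isHom_id K) (isHom_id K) (fun _ _ => rfl) h0
  intro n
  induction n with
  | zero =>
    intro K' p i hn hp hi hpi hP
    have fK : K'.FinDim := finDim_of_inj hK i fun v => Function.LeftInverse.injective (hpi v)
    exact absurd (isZero_of_tdim fK (by omega)) (hnz _ _ hp hP)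
  | succ n ih =>
    intro K' p i hn hp hi hpi hP
    have fK : K'.FinDim := finDim_of_inj hK i fun v => Function.LeftInverse.injective (hpi v)
    by_cases hind : K'.Indec
    · exact ⟨K', p, i, hp, hi, hpi, hP, hind, fK⟩
    have : ∃ Y Z : Repn k Q, Nonempty (Repn.Iso K' (Y.dsum Z)) ∧ ¬ Y.IsZero ∧ ¬ Z.IsZero := by
      by_contra hcon
      push Not at hcon
      refine hind ⟨hnz _ _ hp hP, fun Y Z h => ?_⟩
      by_cases hY : Y.IsZero
      · exact Or.inl hY
      · exact Or.inr (hcon Y Z h hY)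
    obtain ⟨Y, Z, ⟨e⟩, hY, hZ⟩ := this
    let E : Fam K' (Y.dsum Z) := fun v => (e.e v : K'.space v →ₗ[k] (Y.dsum Z).space v)
    let E' : Fam (Y.dsum Z) K' := fun v => ((e.e v).symm : (Y.dsum Z).space v →ₗ[k] K'.space v)
    have hE : IsHom E := iso_isHom e
    have hE' : IsHom E' := iso_symm_isHom e
    have hEE : ∀ v x, E v (E' v x) = x := fun v x => (e.e v).apply_symm_apply x
    have hEE' : ∀ v x, E' v (E v x) = x := fun v x => (e.e v).symm_apply_apply x
    let f1 : Fam (Y.dsum Z) Y := fun v => LinearMap.fst k (Y.space v) (Z.space v)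
    let f2 : Fam (Y.dsum Z) Z := fun v => LinearMap.snd k (Y.space v) (Z.space v)
    let g1 : Fam Y (Y.dsum Z) := fun v => LinearMap.inl k (Y.space v) (Z.space v)
    let g2 : Fam Z (Y.dsum Z) := fun v => LinearMap.inr k (Y.space v) (Z.space v)
    have hf1 : IsHom f1 := fun a x => rfl
    have hf2 : IsHom f2 := fun a x => rfl
    have hg1 : IsHom g1 := fun a x => Prod.ext rfl (map_zero (Z.map a)).symm
    have hg2 : IsHom g2 := fun a x => Prod.ext (map_zero (Y.map a)).symm rfl
    have a1 : ∀ v y, comp f1 E v (comp E' g1 v y) = y := fun v y => by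
      simp only [comp_apply, hEE]; rfl
    have a2 : ∀ v y, comp f2 E v (comp E' g2 v y) = y := fun v y => by
      simp only [comp_apply, hEE]; rfl
    have a3 : ∀ v y, comp f2 E v (comp E' g1 v y) = 0 := fun v y => by
      simp only [comp_apply, hEE]; rfl
    have a3' : ∀ v y, comp f1 E v (comp E' g2 v y) = 0 := fun v y => by
      simp only [comp_apply, hEE]; rfl
    have a4 : ∀ v x, comp E' g1 v (comp f1 E v x) + comp E' g2 v (comp f2 E v x) = x := fun v x => by
      simp only [comp_apply]
      rw [← map_add]
      have : g1 v (f1 v (E v x)) + g2 v (f2 v (E v x)) = E v x :=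
        Prod.ext (add_zero _) (zero_add _)
      rw [this, hEE']
    have b1 : tdim Y < tdim K' := by
      refine tdim_lt_of_inj fK (comp E' g1) (fun v => Function.LeftInverse.injective (a1 v)) ?_
      by_contra hcon
      push Not at hcon
      apply hZ
      intro v z
      obtain ⟨y, hy⟩ := hcon v (comp E' g2 v z)
      have := congrArg (comp f2 E v) hy
      rw [a3, a2] at this
      exact this.symm
    have b2 : tdim Z < tdim K' := by
      refine tdim_lt_of_inj fK (comp E' g2) (fun v => Function.LeftInverse.injective (a2 v)) ?_
      by_contra hcon
      push Not at hcon
      apply hY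
      intro v z
      obtain ⟨y, hy⟩ := hcon v (comp E' g1 v z)
      have := congrArg (comp f1 E v) hy
      rw [a3', a1] at this
      exact this.symm
    rcases hs K' Y Z p (comp f1 E) (comp f2 E) (comp E' g1) (comp E' g2) hp (hf1.comp hE)
      (hf2.comp hE) (hE'.comp hg1) (hE'.comp hg2) a1 a2 a3 a4 hP with h | h
    · refine ih Y _ (comp i (comp E' g1)) (by omega) ((hf1.comp hE).comp hp)
        (hi.comp (hE'.comp hg1)) (fun v y => ?_) h
      show comp f1 E v (p v (i v (comp E' g1 v y))) = y
      rw [hpi, a1]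
    · refine ih Z _ (comp i (comp E' g2)) (by omega) ((hf2.comp hE).comp hp)
        (hi.comp (hE'.comp hg2)) (fun v y => ?_) h
      show comp f2 E v (p v (i v (comp E' g2 v y))) = y
      rw [hpi, a2]

end Basics

end DynkinAut
namespace DynkinAut

section Ringel

variable {k : Type} [Field k] {Q : QuiverData}

lemma not_ext_ker_summand {a b K' : Repn k Q} (ia : a.Indec) (f : Fam a b) (hf : IsHom f)
    (hf0 : ∃ v x, f v x ≠ 0) (hK' : ¬ K'.IsZero) (p : Fam (kerS f hf).repn K') (hp : IsHom p)
    (i : Fam K' (kerS f hf).repn) (hi : IsHom i) (hpi : ∀ v y, p v (i v y) = y) :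
    ¬ Ext0 (rangeS f hf).repn K' := by
  intro hE
  obtain ⟨ψ, hψ, hψi⟩ := exists_extension (incl (kerS f hf)) (isHom_incl _) (incl_inj _)
    (toRange f hf) (isHom_toRange f hf) (toRange_surj f hf)
    (fun v x hx => ⟨⟨x, congrArg Subtype.val hx⟩, rfl⟩)
    (fun v y => Subtype.ext y.2) hE p hp
  obtain ⟨v, x, hx⟩ := hf0
  have := summand_indec ia hK' (comp (incl (kerS f hf)) i) ((isHom_incl _).comp hi) ψ hψ
    (fun v y => by rw [comp_apply, hψi, hpi]) v x
  apply hx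
  rw [← this]
  exact (i v (ψ v x)).2

lemma tdim_ker_summand_lt {a b K' : Repn k Q} (fa : a.FinDim) (f : Fam a b) (hf : IsHom f)
    (hf0 : ∃ v x, f v x ≠ 0) (p : Fam (kerS f hf).repn K')
    (i : Fam K' (kerS f hf).repn) (hpi : ∀ v y, p v (i v y) = y) : tdim K' < tdim a := by
  refine tdim_lt_of_inj fa (comp (incl (kerS f hf)) i) (fun v => ?_) ?_
  · exact (incl_inj _ v).comp (Function.LeftInverse.injective (hpi v))
  · obtain ⟨v, x, hx⟩ := hf0
    refine ⟨v, fun hs => hx ?_⟩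
    obtain ⟨y, rfl⟩ := hs x
    exact (i v y).2

lemma surgery {a b c : Repn k Q} (fa : a.FinDim) (ia : a.Indec) (f : Fam a b) (hf : IsHom f)
    (hf0 : ∃ v x, f v x ≠ 0) (hac : ¬ Ext0 a c) :
    ¬ Ext0 b c ∨ ∃ K : Repn k Q, K.Indec ∧ K.FinDim ∧ tdim K < tdim a ∧ ¬ Ext0 b K ∧
      ¬ Ext0 K c := by
  by_cases hbc : Ext0 b c
  swap
  · exact Or.inl hbc
  right
  have hIc : Ext0 (rangeS f hf).repn c := hbc.of_mono (incl _) (isHom_incl _) (incl_inj _)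
  have hKc : ¬ Ext0 (kerS f hf).repn c := fun hKc => hac <|
    Ext0.of_exact (incl (kerS f hf)) (isHom_incl _) (incl_inj _)
      (toRange f hf) (isHom_toRange f hf) (toRange_surj f hf)
      (fun v x hx => ⟨⟨x, congrArg Subtype.val hx⟩, rfl⟩) hKc hIc
  obtain ⟨K', p, i, hp, hi, hpi, hP, hind, hfin⟩ :=
    exists_indec_summand (kerS f hf).repn (finDim_sub fa _) (fun K' _ => ¬ Ext0 K' c) hKc
    (by
      intro K' Y Z p p1 p2 i1 i2 hp hp1 hp2 hi1 hi2 h11 h22 h21 hsum hE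
      by_contra hcon
      push Not at hcon
      refine hE (Ext0.of_exact i1 hi1 (fun v => Function.LeftInverse.injective (h11 v)) p2 hp2
        (fun v => Function.RightInverse.surjective (h22 v)) (fun v x hx => ⟨p1 v x, ?_⟩) hcon.1 hcon.2)
      have := hsum v x
      rwa [hx, map_zero, add_zero] at this)
    (by
      intro K' p hp hE hz
      refine hE fun g => ⟨fun v => 0, fun a x => ?_⟩
      rw [hz _ x]; simp)
  refine ⟨K', hind, hfin, tdim_ker_summand_lt fa f hf hf0 p i hpi, fun hbK => ?_, hP⟩
  exact not_ext_ker_summand ia f hf hf0 hind.1 p hp i hi hpi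
    (hbK.of_mono (incl _) (isHom_incl _) (incl_inj _))

lemma exists_idem_pow {M : Type*} [Monoid M] [Finite M] (f : M) :
    ∃ m, 0 < m ∧ f ^ m * f ^ m = f ^ m := by
  obtain ⟨a, b, hne, hab⟩ := Finite.exists_ne_map_eq_of_infinite (fun n : ℕ => f ^ n)
  wlog hlt : a < b generalizing a b
  · exact this b a hne.symm hab.symm (by omega)
  obtain ⟨p, rfl⟩ := Nat.exists_eq_add_of_lt hlt
  have h1 : ∀ t, f ^ (a + (p + 1) * t) = f ^ a := by
    intro t
    induction t with
    | zero => simp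
    | succ t ih =>
      have : a + (p + 1) * (t + 1) = (a + (p + 1) * t) + (p + 1) := by ring
      rw [this, pow_add, ih, ← pow_add, ← add_assoc, ← hab]
  refine ⟨(p + 1) * (a + 1), by positivity, ?_⟩
  rw [← pow_add]
  obtain ⟨c, hc⟩ : ∃ c, (p + 1) * (a + 1) = a + c := ⟨p * a + p + 1, by ring⟩
  have : (p + 1) * (a + 1) + (p + 1) * (a + 1) = (a + (p + 1) * (a + 1)) + c := by omega
  rw [this, pow_add, h1, ← pow_add, ← hc]

lemma finite_end [Finite k] {X : Repn k Q} (fX : X.FinDim) :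
    Finite (∀ v, Module.End k (X.space v)) := by
  have : ∀ v, Finite (Module.End k (X.space v)) := fun v => by
    have := fX v
    have : Finite (X.space v) := Module.finite_of_finite k
    exact Finite.of_injective (fun f : Module.End k (X.space v) => (f : X.space v → X.space v))
      DFunLike.coe_injective
  infer_instance

lemma IsHom.pow {X : Repn k Q} (f : ∀ v, Module.End k (X.space v)) (hf : IsHom (M := X) (N := X) f)
    (m : ℕ) : IsHom (M := X) (N := X) (f ^ m) := by
  induction m with
  | zero => exact isHom_id X
  | succ m ih => rw [pow_succ]; exact ih.comp hf

lemma fitting [Finite k] {X : Repn k Q} (iX : X.Indec) (fX : X.FinDim)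
    (f : ∀ v, Module.End k (X.space v)) (hf : IsHom (M := X) (N := X) f) :
    (∃ m, f ^ m = 0) ∨ ∀ v, Function.Bijective (f v) := by
  have := finite_end fX
  obtain ⟨m, hm, he⟩ := exists_idem_pow f
  rcases idem_indec iX (f ^ m) (hf.pow f m) (fun v x => by
    conv_rhs => rw [← he]
    rfl) with h | h
  · left
    exact ⟨m, funext fun v => LinearMap.ext fun x => h v x⟩
  · right
    intro v
    have h1 : f ^ m = 1 := funext fun v => LinearMap.ext fun x => h v x
    have h2 : f v ^ m = 1 := congrFun h1 v
    obtain ⟨n, rfl⟩ : ∃ n, m = n + 1 := ⟨m - 1, by omega⟩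
    constructor
    · refine Function.LeftInverse.injective (g := fun x => (f v ^ n) x) fun x => ?_
      have := LinearMap.congr_fun ((pow_succ (f v) n).symm.trans h2) x
      exact this
    · refine Function.RightInverse.surjective (g := fun x => (f v ^ n) x) fun x => ?_
      have := LinearMap.congr_fun ((pow_succ' (f v) n).symm.trans h2) x
      exact this

lemma exists_sq_zero [Finite k] {X : Repn k Q} (iX : X.Indec) (fX : X.FinDim)
    (f : Fam X X) (hf : IsHom f) (hf0 : ∃ v x, f v x ≠ 0) (hnb : ¬ ∀ v, Function.Bijective (f v)) :
    ∃ g : Fam X X, IsHom g ∧ (∃ v x, g v x ≠ 0) ∧ ∀ v x, g v (g v x) = 0 := by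
  classical
  let F : ∀ v, Module.End k (X.space v) := f
  rcases fitting iX fX F hf with h | h
  swap
  · exact absurd h hnb
  have hmin := Nat.find_spec h
  have hlt := fun m => Nat.find_min h (m := m)
  set m := Nat.find h with hm
  obtain ⟨v, x, hx⟩ := hf0
  have h0 : m ≠ 0 := by
    intro h0
    rw [h0, pow_zero] at hmin
    apply hx
    have : (1 : ∀ v, Module.End k (X.space v)) v (f v x) =
      (0 : ∀ v, Module.End k (X.space v)) v (f v x) := by rw [hmin]
    exact this
  have h1 : m ≠ 1 := by
    intro h1
    rw [h1, pow_one] at hmin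
    apply hx
    exact LinearMap.congr_fun (congrFun hmin v) x
  refine ⟨F ^ (m - 1), hf.pow F _, ?_, ?_⟩
  · by_contra hcon
    push Not at hcon
    exact hlt (m - 1) (by omega) (funext fun v => LinearMap.ext fun x => hcon v x)
  · intro v x
    have : F ^ (m - 1) * F ^ (m - 1) = 0 := by
      rw [← pow_add]
      have : m - 1 + (m - 1) = m + (m - 2) := by omega
      rw [this, pow_add, hmin, zero_mul]
    exact LinearMap.congr_fun (congrFun this v) x

lemma ringel [Finite k] {X : Repn k Q} (iX : X.Indec) (fX : X.FinDim)
    (f : Fam X X) (hf : IsHom f) (hf0 : ∃ v x, f v x ≠ 0) (hnb : ¬ ∀ v, Function.Bijective (f v)) :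
    ∃ K : Repn k Q, K.Indec ∧ K.FinDim ∧ tdim K < tdim X ∧ ¬ Ext0 K K := by
  classical
  let rk : Fam X X → ℕ := fun g => ∑ v, Module.finrank k (LinearMap.range (g v))
  have hex : ∃ n, ∃ g : Fam X X, (IsHom g ∧ (∃ v x, g v x ≠ 0) ∧ ∀ v x, g v (g v x) = 0) ∧
      rk g = n := by
    obtain ⟨g, hg⟩ := exists_sq_zero iX fX f hf hf0 hnb
    exact ⟨_, g, hg, rfl⟩
  obtain ⟨g, ⟨hg, hg0, hg2⟩, hgn⟩ := Nat.find_spec hex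
  have hmin : ∀ g' : Fam X X, IsHom g' → (∃ v x, g' v x ≠ 0) → (∀ v x, g' v (g' v x) = 0) →
      rk g ≤ rk g' := by
    intro g' h1 h2 h3
    rw [hgn]
    exact Nat.find_min' hex ⟨g', ⟨h1, h2, h3⟩, rfl⟩
  clear hgn hex hf hf0 hnb f
  let F : Fam X (kerS g hg).repn := fun v => LinearMap.codRestrict (LinearMap.ker (g v)) (g v)
    (fun x => hg2 v x)
  have hF : IsHom F := fun a x => Subtype.ext (hg a x)
  have hiF : ∀ v x, incl (kerS g hg) v (F v x) = g v x := fun v x => rfl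
  obtain ⟨K', p, i, hp, hi, hpi, hP, hind, hfin⟩ :=
    exists_indec_summand (kerS g hg).repn (finDim_sub fX _)
    (fun K' p => ∃ v x, p v (F v x) ≠ 0)
    (by
      obtain ⟨v, x, hx⟩ := hg0
      refine ⟨v, x, fun h => hx ?_⟩
      rw [← hiF]
      have h' : F v x = 0 := h
      rw [h', map_zero])
    (by
      rintro K' Y Z p p1 p2 i1 i2 hp hp1 hp2 hi1 hi2 h11 h22 h21 hsum ⟨v, x, hx⟩
      by_contra hcon
      push Not at hcon
      apply hx
      rw [← hsum v (p v (F v x))]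
      have e1 := hcon.1 v x
      have e2 := hcon.2 v x
      rw [comp_apply] at e1 e2
      rw [e1, e2]; simp)
    (by
      rintro K' p hp ⟨v, x, hx⟩ hz
      exact hx (hz _ _))
  -- inclusion of the image into the kernel
  let j : Fam (rangeS g hg).repn (kerS g hg).repn := fun v =>
    LinearMap.codRestrict (LinearMap.ker (g v)) (LinearMap.range (g v)).subtype (by
      rintro ⟨_, y, rfl⟩
      exact hg2 v y)
  have hj : IsHom j := fun a x => rfl
  let W : Fam (rangeS g hg).repn X := comp (incl (kerS g hg)) (comp i (comp p j))
  have hW : IsHom W := (isHom_incl _).comp (hi.comp (hp.comp hj))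
  have inji : ∀ v, Function.Injective (i v) := fun v => Function.LeftInverse.injective (hpi v)
  have hWg : ∀ v x, comp W (toRange g hg) v x = incl (kerS g hg) v (i v (p v (F v x))) :=
    fun v x => rfl
  have hgK : ∀ v (y : (kerS g hg).repn.space v), g v (incl (kerS g hg) v y) = 0 := fun v y => y.2
  have hFK : ∀ v (y : (kerS g hg).repn.space v), F v (incl (kerS g hg) v y) = 0 :=
    fun v y => Subtype.ext y.2
  have hle := hmin (comp W (toRange g hg)) (hW.comp (isHom_toRange g hg))
    (by
      obtain ⟨v, x, hx⟩ := hP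
      refine ⟨v, x, fun h => hx ?_⟩
      rw [hWg] at h
      apply inji v
      apply incl_inj _ v
      rw [h, map_zero, map_zero])
    (by
      intro v x
      rw [hWg, hWg, hFK, map_zero, map_zero, map_zero])
  have hfd : ∀ v, FiniteDimensional k (X.space v) := fX
  have hpt : ∀ v, Module.finrank k (LinearMap.range (comp W (toRange g hg) v)) =
      Module.finrank k (LinearMap.range (W v)) := by
    intro v
    have : LinearMap.range (comp W (toRange g hg) v) = LinearMap.range (W v) :=
      LinearMap.range_comp_of_range_eq_top _ (LinearMap.range_eq_top.mpr (toRange_surj g hg v))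
    rw [this]
  have hfr := finDim_sub fX (rangeS g hg)
  have hle2 : ∀ v, Module.finrank k (LinearMap.range (comp W (toRange g hg) v)) ≤
      Module.finrank k (LinearMap.range (g v)) := by
    intro v
    have := hfr v
    rw [hpt]
    exact LinearMap.finrank_range_le (W v)
  have heq : ∀ v, Module.finrank k (LinearMap.range (comp W (toRange g hg) v)) =
      Module.finrank k (LinearMap.range (g v)) := by
    intro v
    exact (Finset.sum_eq_sum_iff_of_le (fun v _ => hle2 v)).mp
      (le_antisymm (Finset.sum_le_sum fun v _ => hle2 v) hle) v (Finset.mem_univ v)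
  have hWinj : ∀ v, Function.Injective (W v) := by
    intro v
    have := hfr v
    have h1 := LinearMap.finrank_range_add_finrank_ker (W v)
    rw [← hpt, heq] at h1
    have h2 : Module.finrank k ((rangeS g hg).repn.space v) =
      Module.finrank k (LinearMap.range (g v)) := rfl
    rw [h2] at h1
    have h3 : Module.finrank k (LinearMap.ker (W v)) = 0 := by omega
    exact LinearMap.ker_eq_bot.mp (Submodule.finrank_eq_zero.mp h3)
  have hpj : ∀ v, Function.Injective (comp p j v) := by
    intro v
    have : Function.Injective (fun x => incl (kerS g hg) v (i v (comp p j v x))) := hWinj v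
    exact Function.Injective.of_comp (f := fun y => incl (kerS g hg) v (i v y)) this
  refine ⟨K', hind, hfin, tdim_ker_summand_lt fX g hg hg0 p i hpi, fun hE => ?_⟩
  exact not_ext_ker_summand iX g hg hg0 hind.1 p hp i hi hpi
    (hE.of_mono (comp p j) (hp.comp hj) hpj)

end Ringel

end DynkinAut
namespace DynkinAut

section Euler

variable {k : Type} [Field k] {Q : QuiverData}

/-- integral dimension vector -/
noncomputable def dv (M : Repn k Q) : Q.V → ℤ := natc (Repn.dimv M)

lemma euler_eq {M N : Repn k Q} (fM : M.FinDim) (fN : N.FinDim) :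
    eulerZ Q (dv M) (dv N) = (homDim M N : ℤ) - extDim M N := by
  have h1 : ∀ v, FiniteDimensional k (M.space v) := fM
  have h2 : ∀ v, FiniteDimensional k (N.space v) := fN
  have e1 := LinearMap.finrank_range_add_finrank_ker (extMap M N)
  have e2 := Submodule.finrank_quotient_add_finrank (LinearMap.range (extMap M N))
  have e3 : Module.finrank k (∀ v, M.space v →ₗ[k] N.space v) =
      ∑ v, Module.finrank k (M.space v) * Module.finrank k (N.space v) := by
    rw [Module.finrank_pi_fintype]
    exact Finset.sum_congr rfl fun v _ => Module.finrank_linearMap k k _ _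
  have e4 : Module.finrank k (∀ a : Q.A, M.space (Q.s a) →ₗ[k] N.space (Q.t a)) =
      ∑ a, Module.finrank k (M.space (Q.s a)) * Module.finrank k (N.space (Q.t a)) := by
    rw [Module.finrank_pi_fintype]
    exact Finset.sum_congr rfl fun v _ => Module.finrank_linearMap k k _ _
  have e5 : (∑ v, dv M v * dv N v) =
      ((∑ v, Module.finrank k (M.space v) * Module.finrank k (N.space v) : ℕ) : ℤ) := by
    push_cast; rfl
  have e6 : (∑ a, dv M (Q.s a) * dv N (Q.t a)) =
      ((∑ a, Module.finrank k (M.space (Q.s a)) * Module.finrank k (N.space (Q.t a)) : ℕ) : ℤ) := by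
    push_cast; rfl
  unfold eulerZ homDim extDim
  rw [e5, e6, ← e3, ← e4, ← e1, ← e2]
  push_cast
  ring

lemma ext0_iff {M N : Repn k Q} : Ext0 M N ↔ LinearMap.range (extMap M N) = ⊤ := by
  rw [LinearMap.range_eq_top]
  constructor
  · intro h g
    obtain ⟨f, hf⟩ := h g
    exact ⟨f, funext fun a => LinearMap.ext fun x => by rw [extMap_apply, hf]⟩
  · intro h g
    obtain ⟨f, hf⟩ := h g
    exact ⟨f, fun a x => by rw [← hf, extMap_apply]⟩

lemma extDim_eq_zero {M N : Repn k Q} (h : Ext0 M N) : extDim M N = 0 := by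
  unfold extDim
  rw [ext0_iff.mp h]
  exact Module.finrank_zero_of_subsingleton

lemma homDim_eq_zero {M N : Repn k Q} (h : ∀ f : Fam M N, IsHom f → ∀ v x, f v x = 0) :
    homDim M N = 0 := by
  have : LinearMap.ker (extMap M N) = ⊥ := by
    rw [eq_bot_iff]
    intro f hf
    rw [mem_ker_extMap] at hf
    rw [Submodule.mem_bot]
    exact funext fun v => LinearMap.ext fun x => h f hf v x
  unfold homDim
  rw [this]
  exact finrank_bot k _

lemma homDim_pos {M N : Repn k Q} (fM : M.FinDim) (fN : N.FinDim) (f : Fam M N) (hf : IsHom f)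
    (hf0 : ∃ v x, f v x ≠ 0) : 0 < homDim M N := by
  have h1 : ∀ v, FiniteDimensional k (M.space v) := fM
  have h2 : ∀ v, FiniteDimensional k (N.space v) := fN
  unfold homDim
  rw [Nat.pos_iff_ne_zero, Ne, Submodule.finrank_eq_zero]
  intro h
  obtain ⟨v, x, hx⟩ := hf0
  have := (mem_ker_extMap f).mpr hf
  rw [h, Submodule.mem_bot] at this
  apply hx
  rw [this]; rfl

/-- bricks -/
def Brick (X : Repn k Q) : Prop :=
  ∀ f : Fam X X, IsHom f → (∃ v x, f v x ≠ 0) → ∀ v, Function.Bijective (f v)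

lemma end_le_ext {X Y : Repn k Q} (fX : X.FinDim) (fY : Y.FinDim) (bX : Brick X)
    (h : ¬ Ext0 X Y) : homDim X X ≤ extDim X Y := by
  have h1 : ∀ v, FiniteDimensional k (X.space v) := fX
  have h2 : ∀ v, FiniteDimensional k (Y.space v) := fY
  have : ∃ ξ, ξ ∉ LinearMap.range (extMap X Y) := by
    by_contra hcon
    push Not at hcon
    exact h (ext0_iff.mpr (eq_top_iff.mpr fun ξ _ => hcon ξ))
  obtain ⟨ξ, hξ⟩ := this
  let T : Fam X X →ₗ[k] (∀ a : Q.A, X.space (Q.s a) →ₗ[k] Y.space (Q.t a)) :=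
    LinearMap.pi fun a => (LinearMap.llcomp k _ _ _ (ξ a)).comp (LinearMap.proj (Q.s a))
  have hT : ∀ θ a x, T θ a x = ξ a (θ _ x) := fun θ a x => rfl
  let S := ((LinearMap.range (extMap X Y)).mkQ.comp T).comp (LinearMap.ker (extMap X X)).subtype
  have hS : Function.Injective S := by
    rw [injective_iff_map_eq_zero]
    rintro ⟨θ, hθ⟩ h0
    have h0' : T θ ∈ LinearMap.range (extMap X Y) := (Submodule.Quotient.mk_eq_zero _).mp h0
    rw [mem_ker_extMap] at hθ
    by_contra hne
    have hne' : ∃ v x, θ v x ≠ 0 := by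
      by_contra hcon
      push Not at hcon
      exact hne (Subtype.ext (funext fun v => LinearMap.ext fun x => hcon v x))
    have hb := bX θ hθ hne'
    let e : ∀ v, X.space v ≃ₗ[k] X.space v := fun v => LinearEquiv.ofBijective (θ v) (hb v)
    have hin := iso_symm_isHom (M := X) (N := X) ⟨e, hθ⟩
    obtain ⟨φ, hφ⟩ := h0'
    apply hξ
    refine ⟨comp φ (fun v => ((e v).symm : X.space v →ₗ[k] X.space v)), ?_⟩
    funext a
    ext x
    have h3 := congrArg (fun g => g a ((e _).symm x)) hφ
    simp only [hT] at h3
    rw [extMap_apply] at h3 ⊢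
    simp only [comp_apply]
    rw [hin a x]
    refine h3.trans ?_
    congr 1
    exact (e _).apply_symm_apply x
  exact LinearMap.finrank_le_finrank_of_injective hS

lemma euler_add_left (d d' e : Q.V → ℤ) :
    eulerZ Q (d + d') e = eulerZ Q d e + eulerZ Q d' e := by
  simp only [eulerZ, Pi.add_apply, add_mul, Finset.sum_add_distrib]
  ring

lemma euler_add_right (d e e' : Q.V → ℤ) :
    eulerZ Q d (e + e') = eulerZ Q d e + eulerZ Q d e' := by
  simp only [eulerZ, Pi.add_apply, mul_add, Finset.sum_add_distrib]
  ring

lemma euler_sum_left (L : List (Q.V → ℤ)) (e : Q.V → ℤ) :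
    eulerZ Q L.sum e = (L.map fun d => eulerZ Q d e).sum := by
  induction L with
  | nil => simp [eulerZ]
  | cons a l ih => simp [euler_add_left, ih]

lemma euler_sum_right (L : List (Q.V → ℤ)) (d : Q.V → ℤ) :
    eulerZ Q d L.sum = (L.map fun e => eulerZ Q d e).sum := by
  induction L with
  | nil => simp [eulerZ]
  | cons a l ih => simp [euler_add_right, ih]

lemma dv_nonneg (M : Repn k Q) (v : Q.V) : 0 ≤ dv M v := Int.natCast_nonneg _

lemma dv_ne_zero {M : Repn k Q} (fM : M.FinDim) (h : ¬ M.IsZero) : ∃ v, 0 < dv M v := by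
  by_contra hcon
  push Not at hcon
  apply h
  apply isZero_of_tdim fM
  refine Finset.sum_eq_zero fun v _ => ?_
  have h1 := hcon v
  have h2 : dv M v = (Module.finrank k (M.space v) : ℤ) := rfl
  omega

lemma list_sum_nonpos (l : List ℤ) (h : ∀ z ∈ l, z ≤ 0) : l.sum ≤ 0 := by
  induction l with
  | nil => simp
  | cons a l ih =>
    have h1 := h a (by simp)
    have h2 := ih fun z hz => h z (by simp [hz])
    rw [List.sum_cons]
    omega

/-- There are no cycles of indecomposables with respect to nonvanishing `Ext¹`. -/
theorem no_cycle [Finite k] (hpos : ∀ d : Q.V → ℤ, d ≠ 0 → 0 < titsZ Q d) (n : ℕ) :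
    ∀ L : List (Repn k Q), L ≠ [] → (∀ X ∈ L, X.Indec ∧ X.FinDim) →
      Cycle.Chain (fun X Y => ¬ Ext0 X Y) (L : Cycle (Repn k Q)) →
      (L.map tdim).sum ≤ n → False := by
  induction n using Nat.strong_induction_on with
  | _ n ih =>
  intro L hL hI hc hn
  -- every rotation
  have key : ∀ x l, (x :: l) ~r L →
      (((x :: l).map fun y => eulerZ Q (dv x) (dv y)).sum ≤ 0) := by
    intro x l hrot
    have hI' : ∀ X ∈ x :: l, X.Indec ∧ X.FinDim := fun X hX => hI X (hrot.perm.mem_iff.mp hX)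
    have hc' : Cycle.Chain (fun X Y => ¬ Ext0 X Y) ((x :: l : List _) : Cycle (Repn k Q)) := by
      rw [Cycle.coe_eq_coe.mpr hrot]; exact hc
    have hn' : ((x :: l).map tdim).sum ≤ n := by
      rw [(hrot.perm.map tdim).sum_eq]; exact hn
    rw [Cycle.chain_coe_cons] at hc'
    obtain ⟨ix, fx⟩ := hI' x (by simp)
    rw [List.map_cons, List.sum_cons] at hn'
    have brick : Brick x := by
      intro f hf hf0
      by_contra hnb
      obtain ⟨K, iK, fK, hlt, hE⟩ := ringel ix fx f hf hf0 hnb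
      refine ih (tdim K) (by omega) [K] (by simp) (by simpa using ⟨iK, fK⟩) ?_ (by simp)
      rw [Cycle.chain_singleton]
      exact hE
    have homz : ∀ y ∈ l, homDim x y = 0 := by
      intro y hy
      obtain ⟨iy, fy⟩ := hI' y (by simp [hy])
      apply homDim_eq_zero
      intro f hf
      by_contra hf0
      push Not at hf0
      obtain ⟨l1, l2, rfl⟩ := List.append_of_mem hy
      have hch : List.IsChain (fun X Y => ¬ Ext0 X Y) (x :: (l1 ++ [y])) := by
        have : x :: (l1 ++ y :: l2 ++ [x]) = (x :: (l1 ++ [y])) ++ (l2 ++ [x]) := by simp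
        rw [this] at hc'
        exact hc'.left_of_append
      obtain ⟨c, l', hcl⟩ : ∃ c l', l1 ++ [y] = c :: l' := List.exists_cons_of_ne_nil (by simp)
      rw [hcl, List.isChain_cons_cons] at hch
      simp only [List.map_append, List.map_cons, List.sum_append, List.sum_cons] at hn'
      have xpos : 0 < tdim x := by
        rw [Nat.pos_iff_ne_zero]; exact fun h => ix.1 (isZero_of_tdim fx h)
      rcases surgery fx ix f hf hf0 hch.1 with h | ⟨K, iK, fK, hlt, hyK, hKc⟩
      · refine ih (tdim y + (l1.map tdim).sum) (by omega) (y :: l1) (by simp) ?_ ?_ (by simp)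
        · intro X hX
          apply hI' X
          simp only [List.mem_cons, List.mem_append] at hX ⊢
          tauto
        · rw [Cycle.chain_coe_cons, hcl, List.isChain_cons_cons]
          exact ⟨h, hch.2⟩
      · refine ih (tdim K + ((l1.map tdim).sum + tdim y)) (by omega) (K :: (l1 ++ [y])) (by simp)
          ?_ ?_ (by simp)
        · intro X hX
          simp only [List.mem_cons, List.mem_append, List.not_mem_nil, or_false] at hX
          rcases hX with rfl | hX | rfl
          · exact ⟨iK, fK⟩
          · exact hI' X (by simp [hX])
          · exact ⟨iy, fy⟩
        · rw [Cycle.chain_coe_cons, List.append_assoc]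
          have : K :: (l1 ++ ([y] ++ [K])) = (K :: l1) ++ (y :: [K]) := by simp
          rw [this, List.isChain_split]
          refine ⟨?_, ?_⟩
          · rw [List.cons_append, hcl, List.isChain_cons_cons]
            exact ⟨hKc, hch.2⟩
          · simpa using hyK
    have hle : ∀ y ∈ l, eulerZ Q (dv x) (dv y) ≤ 0 := by
      intro y hy
      rw [euler_eq fx (hI' y (by simp [hy])).2, homz y hy]
      simp
    have hsl : ∀ l' : List (Repn k Q), (∀ y ∈ l', eulerZ Q (dv x) (dv y) ≤ 0) →
        (l'.map fun y => eulerZ Q (dv x) (dv y)).sum ≤ 0 := by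
      intro l' h
      apply list_sum_nonpos
      intro z hz
      obtain ⟨y, hy, rfl⟩ := List.mem_map.mp hz
      exact h y hy
    rw [List.map_cons, List.sum_cons, euler_eq fx fx]
    cases l with
    | nil =>
      have : ¬ Ext0 x x := by simpa using hc'
      have := end_le_ext fx fx brick this
      simp
      omega
    | cons y l' =>
      obtain ⟨iy, fy⟩ := hI' y (by simp)
      rw [List.cons_append, List.isChain_cons_cons] at hc'
      have h1 := end_le_ext fx fy brick hc'.1
      have h2 := hsl l' (fun z hz => hle z (by simp [hz]))
      rw [List.map_cons, List.sum_cons, euler_eq fx fy, homz y (by simp)]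
      push_cast
      omega
  have hS : (L.map dv).sum ≠ 0 := by
    obtain ⟨x, l, rfl⟩ := List.exists_cons_of_ne_nil hL
    obtain ⟨ix, fx⟩ := hI x (by simp)
    obtain ⟨v, hv⟩ := dv_ne_zero fx ix.1
    intro h
    have hnn : ∀ l : List (Repn k Q), 0 ≤ (l.map dv).sum v := by
      intro l
      induction l with
      | nil => simp
      | cons a l ih =>
        rw [List.map_cons, List.sum_cons, Pi.add_apply]
        have := dv_nonneg a v
        omega
    have h1 := congrFun h v
    rw [List.map_cons, List.sum_cons, Pi.add_apply, Pi.zero_apply] at h1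
    have := hnn l
    omega
  have h1 := hpos _ hS
  unfold titsZ at h1
  rw [euler_sum_left, List.map_map] at h1
  have h2 : (L.map ((fun d => eulerZ Q d (L.map dv).sum) ∘ dv)).sum ≤ 0 := by
    apply list_sum_nonpos
    intro z hz
    obtain ⟨x, hx, rfl⟩ := List.mem_map.mp hz
    obtain ⟨l1, l2, rfl⟩ := List.append_of_mem hx
    have hrot : (x :: (l2 ++ l1)) ~r (l1 ++ x :: l2) := by
      have := List.isRotated_append (l := x :: l2) (l' := l1)
      simpa using this
    have h3 := key x (l2 ++ l1) hrot
    rw [Function.comp_apply, euler_sum_right, List.map_map]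
    rw [(hrot.perm.map _).sum_eq] at h3
    exact h3
  omega

end Euler

end DynkinAut
namespace DynkinAut

section Consequences

variable {k : Type} [Field k] [Finite k] {Q : QuiverData}

lemma ext_self (hpos : ∀ d : Q.V → ℤ, d ≠ 0 → 0 < titsZ Q d) {X : Repn k Q} (iX : X.Indec)
    (fX : X.FinDim) : Ext0 X X := by
  by_contra h
  refine no_cycle hpos (tdim X) (X :: List.nil) (by simp) (by simpa using ⟨iX, fX⟩) ?_ (by simp)
  rw [Cycle.chain_singleton]
  exact h

lemma brick_of_indec (hpos : ∀ d : Q.V → ℤ, d ≠ 0 → 0 < titsZ Q d) {X : Repn k Q}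
    (iX : X.Indec) (fX : X.FinDim) : Brick X := by
  intro f hf hf0
  by_contra hnb
  obtain ⟨K, iK, fK, -, hE⟩ := ringel iX fX f hf hf0 hnb
  exact hE (ext_self hpos iK fK)

lemma ext_of_hom (hpos : ∀ d : Q.V → ℤ, d ≠ 0 → 0 < titsZ Q d) {X Y : Repn k Q} (iX : X.Indec)
    (fX : X.FinDim) (iY : Y.Indec) (fY : Y.FinDim) (f : Fam X Y) (hf : IsHom f)
    (hf0 : ∃ v x, f v x ≠ 0) : Ext0 X Y := by
  by_contra h
  rcases surgery fX iX f hf hf0 h with h | ⟨K, iK, fK, -, h1, h2⟩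
  · exact h (ext_self hpos iY fY)
  · refine no_cycle hpos _ [Y, K] (by simp) (by simpa using ⟨⟨iY, fY⟩, iK, fK⟩) ?_ le_rfl
    rw [Cycle.chain_coe_cons]
    simpa using ⟨h1, h2⟩

lemma homDim_formula (hpos : ∀ d : Q.V → ℤ, d ≠ 0 → 0 < titsZ Q d) {X Y : Repn k Q}
    (iX : X.Indec) (fX : X.FinDim) (iY : Y.Indec) (fY : Y.FinDim) :
    homDim X Y = (eulerZ Q (dv X) (dv Y)).toNat := by
  have h := euler_eq fX fY
  by_cases hE : Ext0 X Y
  · rw [extDim_eq_zero hE] at h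
    omega
  · have : homDim X Y = 0 := by
      apply homDim_eq_zero
      intro f hf
      by_contra hf0
      push Not at hf0
      exact hE (ext_of_hom hpos iX fX iY fY f hf hf0)
    omega

lemma iso_of_dimv (hpos : ∀ d : Q.V → ℤ, d ≠ 0 → 0 < titsZ Q d) {X Y : Repn k Q}
    (iX : X.Indec) (fX : X.FinDim) (iY : Y.Indec) (fY : Y.FinDim) (hd : dv X = dv Y)
    (ht : titsZ Q (dv X) = 1) : Nonempty (Repn.Iso X Y) := by
  have h1 : homDim X Y = 1 := by
    rw [homDim_formula hpos iX fX iY fY, ← hd]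
    unfold titsZ at ht
    rw [ht]; rfl
  have hex : ∃ f : Fam X Y, IsHom f ∧ ∃ v x, f v x ≠ 0 := by
    by_contra hcon
    push Not at hcon
    have := homDim_eq_zero hcon
    omega
  obtain ⟨f, hf, hf0⟩ := hex
  by_cases hb : ∀ v, Function.Surjective (f v)
  · have hb' : ∀ v, Function.Bijective (f v) := fun v => by
      have := fX v
      have := fY v
      have hv : Module.finrank k (X.space v) = Module.finrank k (Y.space v) := by
        have := congrFun hd v
        exact_mod_cast (show ((Module.finrank k (X.space v) : ℕ) : ℤ) =
          ((Module.finrank k (Y.space v) : ℕ) : ℤ) from this)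
      exact ⟨(LinearMap.injective_iff_surjective_of_finrank_eq_finrank hv).mpr (hb v), hb v⟩
    exact ⟨⟨fun v => LinearEquiv.ofBijective (f v) (hb' v), hf⟩⟩
  · exfalso
    have fI := finDim_sub fY (rangeS f hf)
    have e1 := euler_eq fX fI
    have e2 := euler_eq fY fI
    rw [extDim_eq_zero ((ext_self hpos iX fX).of_epi (toRange f hf) (isHom_toRange f hf)
      (toRange_surj f hf))] at e1
    have p1 : 0 < homDim X (rangeS f hf).repn := by
      obtain ⟨v, x, hx⟩ := hf0
      exact homDim_pos fX fI (toRange f hf) (isHom_toRange f hf)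
        ⟨v, x, fun h => hx (congrArg Subtype.val h)⟩
    have p2 : homDim Y (rangeS f hf).repn = 0 := by
      apply homDim_eq_zero
      intro g hg
      by_contra hg0
      push Not at hg0
      obtain ⟨w, y, hy⟩ := hg0
      have hbij := brick_of_indec hpos iY fY (comp (incl _) g) ((isHom_incl _).comp hg)
        ⟨w, y, fun h => hy (incl_inj _ w (by rw [map_zero]; exact h))⟩
      apply hb
      intro v z
      obtain ⟨u, hu⟩ := (hbij v).2 z
      obtain ⟨x, hx⟩ := (g v u).2
      exact ⟨x, hx.trans hu⟩
    rw [p2, ← hd] at e2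
    omega

lemma comp_zero (hpos : ∀ d : Q.V → ℤ, d ≠ 0 → 0 < titsZ Q d) {X Y : Repn k Q}
    (iX : X.Indec) (fX : X.FinDim) (iY : Y.Indec) (hd : dv X ≠ dv Y)
    (g : Fam X Y) (hg : IsHom g) (f : Fam Y X) (hf : IsHom f) (v : Q.V) (x : X.space v) :
    f v (g v x) = 0 := by
  by_contra hne
  have hb := brick_of_indec hpos iX fX (comp f g) (hf.comp hg) ⟨v, x, hne⟩
  let e : ∀ v, X.space v ≃ₗ[k] X.space v := fun v => LinearEquiv.ofBijective (comp f g v) (hb v)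
  have hin := iso_symm_isHom (M := X) (N := X) ⟨e, hf.comp hg⟩
  have hpi : ∀ v x, (e v).symm (f v (g v x)) = x := fun v x => (e v).symm_apply_apply x
  have hs := summand_indec iY iX.1 g hg
    (comp (fun v => ((e v).symm : X.space v →ₗ[k] X.space v)) f) (hin.comp hf) hpi
  apply hd
  funext w
  have hw : Function.Bijective (g w) :=
    ⟨fun x y hxy => by rw [← hpi w x, ← hpi w y, hxy], fun y => ⟨_, hs w y⟩⟩
  have := LinearEquiv.finrank_eq (LinearEquiv.ofBijective (g w) hw)
  show ((Module.finrank k (X.space w) : ℕ) : ℤ) = (Module.finrank k (Y.space w) : ℕ)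
  rw [this]

lemma scalar (hpos : ∀ d : Q.V → ℤ, d ≠ 0 → 0 < titsZ Q d) {X : Repn k Q}
    (iX : X.Indec) (fX : X.FinDim) (ht : titsZ Q (dv X) = 1) (f : Fam X X) (hf : IsHom f) :
    ∃ c : k, ∀ v x, f v x = c • x := by
  have h1 : homDim X X = 1 := by
    rw [homDim_formula hpos iX fX iX fX]
    unfold titsZ at ht
    rw [ht]; rfl
  have hid : (⟨idF X, (mem_ker_extMap _).mpr (isHom_id X)⟩ : LinearMap.ker (extMap X X)) ≠ 0 := by
    intro h
    apply iX.1
    intro v x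
    exact LinearMap.congr_fun (congrFun (congrArg Subtype.val h) v) x
  obtain ⟨c, hc⟩ := (finrank_eq_one_iff_of_nonzero' _ hid).mp h1
    ⟨f, (mem_ker_extMap _).mpr hf⟩
  exact ⟨c, fun v x => (LinearMap.congr_fun (congrFun (congrArg Subtype.val hc) v) x).symm⟩

end Consequences

section RingCount

lemma isUnit_one_add {E S ι : Type*} [Ring E] [Ring S] [Fintype ι] (φ : E →+* S)
    (e : ι → E) (hsum : ∑ i, e i = 1) (hid : ∀ i, e i * e i = e i)
    (hJ : ∀ j, φ j = 0 → ∀ i, e i * j * e i = 0) (j : E) (hj : φ j = 0) : IsUnit (1 + j) := by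
  have key : ∀ j, φ j = 0 → ∃ z, z * (1 + j) = 1 := by
    intro j hj
    by_contra hcon
    have hne : Ideal.span {1 + j} ≠ ⊤ := by
      intro h
      have : (1 : E) ∈ Ideal.span {1 + j} := by rw [h]; trivial
      exact hcon (Ideal.mem_span_singleton'.mp this)
    obtain ⟨m, hm, hle⟩ := Ideal.exists_le_maximal _ hne
    have h1j : 1 + j ∈ m := hle (Ideal.mem_span_singleton_self _)
    obtain ⟨i, hi⟩ : ∃ i, e i ∉ m := by
      by_contra hall
      push Not at hall
      apply hm.ne_top
      rw [Ideal.eq_top_iff_one, ← hsum]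
      exact Ideal.sum_mem _ fun i _ => hall i
    -- the left ideal of `x` with `J x ⊆ m`
    let T : Ideal E :=
      { carrier := {x | ∀ j, φ j = 0 → j * x ∈ m}
        add_mem' := fun {x y} hx hy j hj => by rw [mul_add]; exact m.add_mem (hx j hj) (hy j hj)
        zero_mem' := fun j _ => by rw [mul_zero]; exact m.zero_mem
        smul_mem' := fun c x hx j hj => by
          rw [smul_eq_mul, ← mul_assoc]
          exact hx _ (by rw [map_mul, hj, zero_mul]) }
    have hmT : m ≤ T := fun x hx j _ => m.mul_mem_left j hx
    have heT : e i ∈ T := by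
      intro j hj
      by_contra hnot
      have hlt : m ⊔ Ideal.span {j * e i} = ⊤ := by
        apply hm.1.2
        refine lt_of_le_of_ne le_sup_left fun heq => hnot ?_
        rw [heq]
        exact Ideal.mem_sup_right (Ideal.mem_span_singleton_self _)
      have : e i ∈ m ⊔ Ideal.span {j * e i} := by rw [hlt]; trivial
      obtain ⟨y, hy, z, hz, hyz⟩ := Submodule.mem_sup.mp this
      obtain ⟨r, rfl⟩ := Ideal.mem_span_singleton'.mp hz
      apply hi
      have h2 : e i = e i * y := by
        have h3 := congrArg (fun t => e i * t) hyz
        simp only [mul_add, hid] at h3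
        rw [← mul_assoc r, ← mul_assoc, hJ (r * j) (by rw [map_mul, hj, mul_zero]),
          add_zero] at h3
        exact h3.symm
      rw [h2]
      exact m.mul_mem_left _ hy
    have hT : T = ⊤ := by
      apply hm.1.2
      exact lt_of_le_of_ne hmT fun heq => hi (heq ▸ heT)
    have h1T : (1 : E) ∈ T := by rw [hT]; trivial
    have hjm := h1T j hj
    rw [mul_one] at hjm
    apply hm.ne_top
    rw [Ideal.eq_top_iff_one]
    have := m.sub_mem h1j hjm
    simpa using this
  obtain ⟨z, hz⟩ := key j hj
  have hz' : z = 1 + -(z * j) := by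
    have h2 : z + z * j = 1 := by rw [← hz, mul_add, mul_one]
    rw [← h2]; abel
  obtain ⟨w, hw⟩ := key (-(z * j)) (by rw [map_neg, map_mul, hj, mul_zero, neg_zero])
  rw [← hz'] at hw
  have hwj : w = 1 + j := by
    calc w = w * (z * (1 + j)) := by rw [hz, mul_one]
      _ = 1 + j := by rw [← mul_assoc, hw, one_mul]
  rw [hwj] at hw
  exact ⟨⟨1 + j, z, hw, hz⟩, rfl⟩

lemma card_units {E S ι : Type*} [Ring E] [Ring S] [Finite E] [Finite S] [Fintype ι]
    (φ : E →+* S) (hφ : Function.Surjective φ)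
    (e : ι → E) (hsum : ∑ i, e i = 1) (hid : ∀ i, e i * e i = e i)
    (hJ : ∀ j, φ j = 0 → ∀ i, e i * j * e i = 0) :
    Nat.card Eˣ * Nat.card S = Nat.card Sˣ * Nat.card E := by
  have hu := isUnit_one_add φ e hsum hid hJ
  have hu' : ∀ x, φ x = 1 → IsUnit x := fun x hx => by
    have := hu (x - 1) (by rw [map_sub, hx, map_one, sub_self])
    simpa using this
  let U : Eˣ →* Sˣ := Units.map (φ : E →* S)
  have hU : Function.Surjective U := by
    intro s
    obtain ⟨f, hf⟩ := hφ s
    obtain ⟨g, hg⟩ := hφ (s⁻¹ : Sˣ)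
    have h1 : IsUnit (f * g) := hu' _ (by rw [map_mul, hf, hg, Units.mul_inv])
    have h2 : IsUnit (g * f) := hu' _ (by rw [map_mul, hf, hg, Units.inv_mul])
    obtain ⟨u, hu1⟩ := h1
    obtain ⟨w, hw⟩ := h2
    have h3 : IsUnit f := by
      rw [isUnit_iff_exists_and_exists]
      refine ⟨⟨g * (u⁻¹ : Eˣ), ?_⟩, ⟨(w⁻¹ : Eˣ) * g, ?_⟩⟩
      · rw [← mul_assoc, ← hu1, Units.mul_inv]
      · rw [mul_assoc, ← hw, Units.inv_mul]
    obtain ⟨f', rfl⟩ := h3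
    exact ⟨f', Units.ext hf⟩
  have c1 : Nat.card Eˣ = Nat.card U.ker * Nat.card Sˣ := by
    rw [← Subgroup.card_mul_index U.ker, Subgroup.index_ker, MonoidHom.range_eq_top.mpr hU,
      Subgroup.card_top]
  let A : E →+ S := φ.toAddMonoidHom
  have c2 : Nat.card E = Nat.card A.ker * Nat.card S := by
    rw [← AddSubgroup.card_mul_index A.ker, AddSubgroup.index_ker,
      AddMonoidHom.range_eq_top.mpr hφ, AddSubgroup.card_top]
  have c3 : Nat.card U.ker = Nat.card A.ker := by
    refine Nat.card_eq_of_bijective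
      (fun u : U.ker => (⟨((u : Eˣ) : E) - 1, ?_⟩ : A.ker)) ⟨?_, ?_⟩
    · have h := congrArg (fun s : Sˣ => (s : S)) (MonoidHom.mem_ker.mp u.2)
      have h' : φ ((u : Eˣ) : E) = 1 := h
      rw [AddMonoidHom.mem_ker]
      show φ _ = 0
      rw [map_sub, h', map_one, sub_self]
    · intro u w h
      have h' : ((u : Eˣ) : E) - 1 = ((w : Eˣ) : E) - 1 := congrArg Subtype.val h
      exact Subtype.ext (Units.ext (sub_left_injective h'))
    · rintro ⟨j, hj⟩
      have hj' : φ j = 0 := hj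
      obtain ⟨u, huj⟩ := hu j hj'
      refine ⟨⟨u, ?_⟩, Subtype.ext ?_⟩
      · rw [MonoidHom.mem_ker]
        refine Units.ext ?_
        show φ (u : E) = 1
        rw [huj, map_add, map_one, hj', add_zero]
      · show (u : E) - 1 = j
        rw [huj]; abel
  rw [c1, c2, c3]
  ring

end RingCount

end DynkinAut
namespace DynkinAut

section Counting

variable {k : Type} [Field k] {Q : QuiverData}

/-- The endomorphism ring of a representation. -/
def endS (M : Repn k Q) : Subring (∀ v, Module.End k (M.space v)) where
  carrier := {f | IsHom (M := M) (N := M) f}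
  mul_mem' := fun {f g} hf hg => IsHom.comp (g := f) (f := g) hf hg
  one_mem' := isHom_id M
  add_mem' := fun {f g} hf hg a x => by
    show f _ _ + g _ _ = M.map a (f _ _ + g _ _)
    rw [hf, hg, map_add]
  zero_mem' := fun a x => by
    show (0 : M.space _) = M.map a (0 : M.space _)
    rw [map_zero]
  neg_mem' := fun {f} hf a x => by
    show - f _ _ = M.map a (- f _ _)
    rw [hf, map_neg]

lemma autCard_eq (M : Repn k Q) : autCard M = Nat.card (endS M)ˣ := by
  unfold autCard
  refine Nat.card_congr
    { toFun := fun e => ⟨⟨fun v => (e.e v : M.space v →ₗ[k] M.space v), iso_isHom e⟩,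
        ⟨fun v => ((e.e v).symm : M.space v →ₗ[k] M.space v), iso_symm_isHom e⟩, ?_, ?_⟩
      invFun := fun u => ⟨fun v => LinearEquiv.ofLinearMap (u.1.1 v) (u⁻¹.1.1 v) ?_ ?_, u.1.2⟩
      left_inv := ?_
      right_inv := ?_ }
  · refine Subtype.ext (funext fun v => LinearMap.ext fun x => ?_)
    exact (e.e v).apply_symm_apply x
  · refine Subtype.ext (funext fun v => LinearMap.ext fun x => ?_)
    exact (e.e v).symm_apply_apply x
  · exact congrFun (congrArg Subtype.val u.mul_inv) v
  · exact congrFun (congrArg Subtype.val u.inv_mul) v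
  · intro e
    cases e
    congr
  · intro u
    refine Units.ext (Subtype.ext (funext fun v => LinearMap.ext fun x => rfl))

lemma autCard_congr {M N : Repn k Q} (e : Repn.Iso M N) : autCard M = autCard N := by
  refine Nat.card_congr
    { toFun := fun f => ⟨fun v => ((e.e v).symm.trans (f.e v)).trans (e.e v), ?_⟩
      invFun := fun f => ⟨fun v => ((e.e v).trans (f.e v)).trans (e.e v).symm, ?_⟩
      left_inv := ?_
      right_inv := ?_ }
  · intro a x
    have h := iso_symm_isHom e a x
    simp only [LinearEquiv.coe_coe] at h
    simp only [LinearEquiv.trans_apply]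
    rw [h, f.comm, e.comm]
  · intro a x
    have h := iso_symm_isHom e a
    simp only [LinearEquiv.coe_coe] at h
    simp only [LinearEquiv.trans_apply]
    rw [e.comm, f.comm, h]
  · rintro ⟨f, hf⟩
    have h : ∀ {K : Repn k Q} (a b : Repn.Iso K K), a.e = b.e → a = b := by
      rintro K ⟨a, _⟩ ⟨b, _⟩ rfl; rfl
    apply h
    funext v
    ext x
    simp
  · rintro ⟨f, hf⟩
    have h : ∀ {K : Repn k Q} (a b : Repn.Iso K K), a.e = b.e → a = b := by
      rintro K ⟨a, _⟩ ⟨b, _⟩ rfl; rfl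
    apply h
    funext v
    ext x
    simp

variable {ι : Type} [Fintype ι] [DecidableEq ι] (X : ι → Repn k Q)

/-- Inclusion of a summand. -/
def inF (t : ι) : Fam (X t) (Repn.dsumFam X) :=
  fun v => LinearMap.single k (fun i => (X i).space v) t

/-- Projection to a summand. -/
def prF (s : ι) : Fam (Repn.dsumFam X) (X s) :=
  fun v => LinearMap.proj (φ := fun i => (X i).space v) s

lemma isHom_inF (t : ι) : IsHom (inF X t) := by
  intro a x
  funext i
  show (Pi.single t ((X t).map a x) : ∀ i, (X i).space _) i =
    (X i).map a ((Pi.single t x : ∀ i, (X i).space _) i)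
  by_cases h : i = t
  · subst h; simp
  · simp [h]

lemma isHom_prF (s : ι) : IsHom (prF X s) := fun _ _ => rfl

lemma sum_inF (v : Q.V) (x : (Repn.dsumFam X).space v) :
    ∑ t, inF X t v (prF X t v x) = x :=
  Finset.univ_sum_single (M := fun i => (X i).space v) x

lemma pr_in_same (s : ι) (v : Q.V) (x : (X s).space v) : prF X s v (inF X s v x) = x :=
  Pi.single_eq_same (M := fun i => (X i).space v) s x

lemma pr_in_ne {s t : ι} (h : s ≠ t) (v : Q.V) (x : (X t).space v) :
    prF X s v (inF X t v x) = 0 :=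
  Pi.single_eq_of_ne (M := fun i => (X i).space v) h x

/-- Matrix entries. -/
def ent (f : Fam (Repn.dsumFam X) (Repn.dsumFam X)) (s t : ι) : Fam (X t) (X s) :=
  comp (prF X s) (comp f (inF X t))

lemma isHom_ent {f : Fam (Repn.dsumFam X) (Repn.dsumFam X)} (hf : IsHom f) (s t : ι) :
    IsHom (ent X f s t) := (isHom_prF X s).comp (hf.comp (isHom_inF X t))

lemma ent_sum (f : Fam (Repn.dsumFam X) (Repn.dsumFam X)) (s : ι) (v : Q.V)
    (x : (Repn.dsumFam X).space v) :
    prF X s v (f v x) = ∑ t, ent X f s t v (prF X t v x) := by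
  conv_lhs => rw [← sum_inF X v x]
  rw [map_sum, map_sum]
  rfl

lemma card_endS [Finite k] (hX : ∀ i, (X i).FinDim) :
    Nat.card (endS (Repn.dsumFam X)) = Nat.card k ^ (∑ s, ∑ t, homDim (X t) (X s)) := by
  have : ∀ i v, Module.Finite k ((X i).space v) := fun i v => hX i v
  have h1 : Nat.card (endS (Repn.dsumFam X)) =
      Nat.card (∀ s t, LinearMap.ker (extMap (X t) (X s))) := by
    refine Nat.card_eq_of_bijective
      (fun f s t => ⟨ent X f.1 s t, (mem_ker_extMap _).mpr (isHom_ent X f.2 s t)⟩) ⟨?_, ?_⟩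
    · intro f g h
      refine Subtype.ext (funext fun v => LinearMap.ext fun x => funext fun s => ?_)
      show prF X s v (f.1 v x) = prF X s v (g.1 v x)
      rw [ent_sum X f.1 s, ent_sum X g.1 s]
      refine Finset.sum_congr rfl fun t _ => ?_
      have := congrArg Subtype.val (congrFun (congrFun h s) t)
      exact LinearMap.congr_fun (congrFun this v) _
    · intro h
      let F : Fam (Repn.dsumFam X) (Repn.dsumFam X) := fun v =>
        LinearMap.pi (φ := fun i => (X i).space v) fun s => ∑ t, (h s t).1 v ∘ₗ prF X t v
      have hF : ∀ v x s, prF X s v (F v x) = ∑ t, (h s t).1 v (prF X t v x) := by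
        intro v x s
        show (∑ t, (h s t).1 v ∘ₗ prF X t v) x = _
        rw [LinearMap.sum_apply]
        rfl
      have hFh : IsHom F := by
        intro a x
        funext s
        show prF X s _ (F _ _) = (X s).map a (prF X s _ (F _ x))
        rw [hF, hF, map_sum]
        refine Finset.sum_congr rfl fun t _ => ?_
        rw [isHom_prF, (mem_ker_extMap _).mp (h s t).2]
      refine ⟨⟨F, hFh⟩, ?_⟩
      funext s t
      refine Subtype.ext (funext fun v => LinearMap.ext fun x => ?_)
      show prF X s v (F v (inF X t v x)) = _
      rw [hF, Finset.sum_eq_single t]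
      · rw [pr_in_same]
      · intro u _ hu
        rw [pr_in_ne X hu, map_zero]
      · simp
  rw [h1, Nat.card_pi, Finset.prod_congr rfl (fun s _ => Nat.card_pi)]
  rw [← Finset.prod_pow_eq_pow_sum]
  refine Finset.prod_congr rfl fun s _ => ?_
  rw [← Finset.prod_pow_eq_pow_sum]
  refine Finset.prod_congr rfl fun t _ => ?_
  exact Module.natCard_eq_pow_finrank

end Counting

section Main

variable {k : Type} [Field k] [Finite k] {Q : QuiverData}

lemma aut_count (hpos : ∀ d : Q.V → ℤ, d ≠ 0 → 0 < titsZ Q d)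
    {D : Type} [Fintype D] [DecidableEq D] (m : D → ℕ) (Y : D → Repn k Q)
    (iY : ∀ d, (Y d).Indec) (fY : ∀ d, (Y d).FinDim) (tY : ∀ d, titsZ Q (dv (Y d)) = 1)
    (inj : ∀ d e, d ≠ e → dv (Y d) ≠ dv (Y e)) :
    autCard (Repn.dsumFam fun s : (Σ d, Fin (m d)) => Y s.1) * Nat.card k ^ (∑ d, m d * m d) =
      (∏ d, ∏ i : Fin (m d), (Nat.card k ^ m d - Nat.card k ^ (i : ℕ))) *
        Nat.card k ^ (∑ s : (Σ d, Fin (m d)), ∑ t : (Σ d, Fin (m d)), homDim (Y t.1) (Y s.1)) := by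
  classical
  let X : (Σ d, Fin (m d)) → Repn k Q := fun s => Y s.1
  have := Fintype.ofFinite k
  have hfin : Finite (endS (Repn.dsumFam X)) := by
    have : Finite (∀ v, Module.End k ((Repn.dsumFam X).space v)) := by
      apply finite_end
      intro v
      have : ∀ s, Module.Finite k ((X s).space v) := fun s => fY s.1 v
      exact (inferInstance : Module.Finite k (∀ s, (X s).space v))
    infer_instance
  have huniq : ∀ d (c c' : k), (∀ v (x : (Y d).space v), c • x = c' • x) → c = c' := by
    intro d c c' h
    by_contra hne
    apply (iY d).1
    intro v x
    have := h v x
    rw [← sub_eq_zero, ← sub_smul] at this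
    exact (smul_eq_zero.mp this).resolve_left (sub_ne_zero.mpr hne)
  have hc : ∀ (f : endS (Repn.dsumFam X)) (d : D) (a b : Fin (m d)), ∃ c : k,
      ∀ v (x : (Y d).space v), ent X f.1 ⟨d, a⟩ ⟨d, b⟩ v x = c • x := fun f d a b =>
    scalar hpos (iY d) (fY d) (tY d) (ent X f.1 ⟨d, a⟩ ⟨d, b⟩) (isHom_ent X f.2 ⟨d, a⟩ ⟨d, b⟩)
  choose c hc using hc
  let φ : endS (Repn.dsumFam X) →+* (∀ d, Matrix (Fin (m d)) (Fin (m d)) k) :=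
    { toFun := fun f d => Matrix.of fun a b => c f d a b
      map_one' := by
        funext d
        ext a b
        apply huniq d
        intro v x
        rw [Matrix.of_apply, ← hc]
        show prF X ⟨d, a⟩ v (inF X ⟨d, b⟩ v x) = _
        by_cases hab : a = b
        · subst hab
          rw [pr_in_same]; simp
        · rw [pr_in_ne X (by simpa using hab)]; simp [hab]
      map_mul' := by
        intro f g
        funext d
        ext a b
        apply huniq d
        intro v x
        rw [Matrix.of_apply, ← hc]
        show prF X ⟨d, a⟩ v (f.1 v (g.1 v (inF X ⟨d, b⟩ v x))) = _
        rw [ent_sum, Fintype.sum_sigma, Finset.sum_eq_single d]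
        · rw [Pi.mul_apply, Matrix.mul_apply, Finset.sum_smul]
          refine Finset.sum_congr rfl fun u _ => ?_
          rw [hc]
          show _ • ent X g.1 ⟨d, u⟩ ⟨d, b⟩ v x = _
          rw [hc, smul_smul]
          rfl
        · intro e _ hne
          refine Finset.sum_eq_zero fun u _ => ?_
          exact comp_zero hpos (iY d) (fY d) (iY e) (inj d e hne.symm)
            (ent X g.1 ⟨e, u⟩ ⟨d, b⟩) (isHom_ent X g.2 ⟨e, u⟩ ⟨d, b⟩)
            (ent X f.1 ⟨d, a⟩ ⟨e, u⟩) (isHom_ent X f.2 ⟨d, a⟩ ⟨e, u⟩) v x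
        · simp
      map_zero' := by
        funext d
        ext a b
        apply huniq d
        intro v x
        rw [Matrix.of_apply, ← hc]
        show (0 : (Y d).space v) = (0 : k) • x
        rw [zero_smul]
      map_add' := by
        intro f g
        funext d
        ext a b
        apply huniq d
        intro v x
        rw [Matrix.of_apply, ← hc]
        show ent X f.1 ⟨d, a⟩ ⟨d, b⟩ v x + ent X g.1 ⟨d, a⟩ ⟨d, b⟩ v x =
          (c f d a b + c g d a b) • x
        rw [hc, hc, add_smul] }
  have hφ : Function.Surjective φ := by
    intro B
    let F : Fam (Repn.dsumFam X) (Repn.dsumFam X) := fun v =>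
      LinearMap.pi (φ := fun i => (X i).space v) fun s =>
        ∑ b, B s.1 s.2 b • (prF X ⟨s.1, b⟩ v : (Repn.dsumFam X).space v →ₗ[k] (X s).space v)
    have hF : ∀ v x s, prF X s v (F v x) =
        ∑ b, B s.1 s.2 b • (prF X ⟨s.1, b⟩ v x : (X s).space v) := by
      intro v x s
      let G : Fin (m s.1) → ((Repn.dsumFam X).space v →ₗ[k] (X s).space v) :=
        fun b => B s.1 s.2 b • prF X ⟨s.1, b⟩ v
      exact LinearMap.sum_apply Finset.univ G x
    have hFh : IsHom F := by
      intro a x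
      funext s
      show prF X s _ (F _ _) = (X s).map a (prF X s _ (F _ x))
      rw [hF, hF, map_sum]
      refine Finset.sum_congr rfl fun b _ => ?_
      rw [map_smul]
      rfl
    refine ⟨⟨F, hFh⟩, ?_⟩
    funext d
    ext a b
    apply huniq d
    intro v x
    show c ⟨F, hFh⟩ d a b • x = _
    rw [← hc]
    show prF X ⟨d, a⟩ v (F v (inF X ⟨d, b⟩ v x)) = _
    rw [hF, Finset.sum_eq_single b]
    · rw [pr_in_same]
    · intro u _ hu
      rw [pr_in_ne X (by simpa using hu), smul_zero]
    · simp
  have key := card_units φ hφ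
    (fun s => ⟨comp (inF X s) (prF X s), (isHom_inF X s).comp (isHom_prF X s)⟩)
    (by
      refine Subtype.ext (funext fun v => LinearMap.ext fun x => ?_)
      rw [AddSubmonoidClass.coe_finsetSum, Finset.sum_apply, LinearMap.sum_apply]
      exact sum_inF X v x)
    (by
      intro s
      refine Subtype.ext (funext fun v => LinearMap.ext fun x => ?_)
      show inF X s v (prF X s v (inF X s v (prF X s v x))) = inF X s v (prF X s v x)
      rw [pr_in_same])
    (by
      intro j hj s
      refine Subtype.ext (funext fun v => LinearMap.ext fun x => ?_)
      show inF X s v (prF X s v (j.1 v (inF X s v (prF X s v x)))) = 0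
      have h0 : c j s.1 s.2 s.2 = 0 := congrFun (congrFun (congrFun hj s.1) s.2) s.2
      have h1 : prF X s v (j.1 v (inF X s v (prF X s v x))) = 0 := by
        have := hc j s.1 s.2 s.2 v (prF X s v x)
        rw [h0, zero_smul] at this
        exact this
      rw [h1, map_zero])
  rw [← autCard_eq, card_endS X (fun s => fY s.1), Nat.card_congr MulEquiv.piUnits.toEquiv,
    Nat.card_pi, Nat.card_pi] at key
  have e1 : ∀ d, Nat.card (Matrix (Fin (m d)) (Fin (m d)) k) = Nat.card k ^ (m d * m d) := by
    intro d
    rw [Module.natCard_eq_pow_finrank (K := k), Module.finrank_matrix]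
    simp
  have e2 : ∀ d, Nat.card (Matrix (Fin (m d)) (Fin (m d)) k)ˣ =
      ∏ i : Fin (m d), (Nat.card k ^ m d - Nat.card k ^ (i : ℕ)) := by
    intro d
    have := Matrix.card_GL_field (𝔽 := k) (m d)
    rw [Nat.card_eq_fintype_card (α := k)]
    exact this
  rw [Finset.prod_congr rfl (fun d _ => e1 d), Finset.prod_congr rfl (fun d _ => e2 d),
    Finset.prod_pow_eq_pow_sum] at key
  exact key

end Main

end DynkinAut
namespace DynkinAut

section Final

variable {k : Type} [Field k] {Q : QuiverData}

lemma iso_dsumFam {ι κ : Type} (e : κ ≃ ι) (X : ι → Repn k Q) (Y : κ → Repn k Q)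
    (f : ∀ s, Repn.Iso (X (e s)) (Y s)) {A : Repn k Q} (g : Repn.Iso A (Repn.dsumFam X)) :
    Nonempty (Repn.Iso A (Repn.dsumFam Y)) := by
  let L : ∀ v, (∀ i, (X i).space v) ≃ₗ[k] (∀ s, (Y s).space v) := fun v =>
    (LinearEquiv.piCongrLeft k (fun i => (X i).space v) e).symm.trans
      (LinearEquiv.piCongrRight fun s => (f s).e v)
  have hL : ∀ v x s, L v x s = (f s).e v (x (e s)) := fun v x s => rfl
  refine ⟨⟨fun v => (g.e v).trans (L v), ?_⟩⟩
  intro a x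
  funext s
  show L _ (g.e _ (A.map a x)) s = (Y s).map a (L _ (g.e _ x) s)
  rw [g.comm]
  exact (f s).comm a _

/-- The exponent. -/
noncomputable def expo (Q : QuiverData) (α : (Q.V → ℕ) → ℕ) {D : Type} [Fintype D]
    (i : D → Q.V → ℕ) : ℕ := by
  classical
  exact ∑ s : (Σ d, Fin (α (i d))), ∑ t : (Σ d, Fin (α (i d))),
    if s.1 = t.1 then 0 else (eulerZ Q (natc (i t.1)) (natc (i s.1))).toNat

lemma sum_split {D : Type} [Fintype D] [DecidableEq D] (m : D → ℕ) (h : D → D → ℕ)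
    (h1 : ∀ d, h d d = 1) :
    ∑ s : (Σ d, Fin (m d)), ∑ t : (Σ d, Fin (m d)), h t.1 s.1 =
      (∑ d, m d * m d) + ∑ s : (Σ d, Fin (m d)), ∑ t : (Σ d, Fin (m d)),
        if s.1 = t.1 then 0 else h t.1 s.1 := by
  have e1 : ∑ d, m d * m d = ∑ s : (Σ d, Fin (m d)), ∑ t : (Σ d, Fin (m d)),
      if s.1 = t.1 then 1 else 0 := by
    rw [Fintype.sum_sigma]
    refine Finset.sum_congr rfl fun d _ => ?_
    have : ∀ a : Fin (m d), (∑ t : (Σ d, Fin (m d)), if (⟨d, a⟩ : Σ d, Fin (m d)).1 = t.1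
        then 1 else 0) = m d := fun a => by
      rw [Fintype.sum_sigma, Finset.sum_eq_single d]
      · simp
      · intro b _ hb
        simp [hb.symm]
      · simp
    rw [Finset.sum_congr rfl (fun a _ => this a)]
    simp
  rw [e1, ← Finset.sum_add_distrib]
  refine Finset.sum_congr rfl fun s _ => ?_
  rw [← Finset.sum_add_distrib]
  refine Finset.sum_congr rfl fun t _ => ?_
  split_ifs with hst
  · rw [hst, h1]
  · simp

lemma natCard_sub_int (q n : ℕ) (hq : 1 ≤ q) :
    ((∏ i : Fin n, (q ^ n - q ^ (i : ℕ)) : ℕ) : ℤ) = ∏ i : Fin n, ((q : ℤ) ^ n - (q : ℤ) ^ (i : ℕ)) := by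
  rw [Nat.cast_prod]
  refine Finset.prod_congr rfl fun i _ => ?_
  rw [Nat.cast_sub (Nat.pow_le_pow_right hq i.2.le)]
  push_cast
  rfl

end Final

end DynkinAut

/-- For a Dynkin quiver `Q` and each class `α : Φ₊ → ℕ` there is a monic polynomial
`a_α ∈ ℤ[T]` such that for every finite field `k` with `q` elements and every
`kQ`-module `A` with `[A] = α` one has `|Aut(A)| = a_α(q)`. -/
theorem aut_polynomials_exist_dynkin (Q : QuiverData) (hQ : IsDynkin Q)
    (α : (Q.V → ℕ) → ℕ)
    (hαfin : (Function.support α).Finite) (hαroot : ∀ d, α d ≠ 0 → IsPosRoot Q d) :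
    ∃ a : Polynomial ℤ, a.Monic ∧
      ∀ (k : Type) [Field k] [Fintype k] (A : Repn k Q),
        A.FinDim → HasClassDynkin A α →
        (autCard A : ℤ) = a.eval ((Fintype.card k : ℤ)) := by
  classical
  let D := {d : Q.V → ℕ // α d ≠ 0}
  have : Fintype D := hαfin.fintype
  refine ⟨Polynomial.X ^ (DynkinAut.expo Q α (fun d : D => d.1)) *
    ∏ d : D, ∏ i : Fin (α d.1), (Polynomial.X ^ (α d.1) - Polynomial.X ^ (i : ℕ)), ?_, ?_⟩
  · refine (Polynomial.monic_X_pow _).mul (Polynomial.monic_prod_of_monic _ _ fun d _ =>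
      Polynomial.monic_prod_of_monic _ _ fun i _ => ?_)
    refine (Polynomial.monic_X_pow _).sub_of_left ?_
    rw [Polynomial.degree_X_pow, Polynomial.degree_X_pow]
    exact_mod_cast i.2
  · intro k _ _ A _ ⟨ι, _, Xi, r, hX, hμ, ⟨g⟩⟩
    have hpos := hQ.2
    have hr : ∀ i, α (r i) ≠ 0 := by
      intro i
      rw [hμ]
      have : Nonempty {j // r j = r i} := ⟨⟨i, rfl⟩⟩
      exact Nat.card_pos.ne'
    let r' : ι → D := fun i => ⟨r i, hr i⟩
    have hfib : ∀ d : D, Nonempty (Fin (α d.1) ≃ {i // r' i = d}) := fun d => by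
      have h : α d.1 = Nat.card {i // r' i = d} := by
        rw [hμ]
        exact Nat.card_congr (Equiv.subtypeEquivRight fun i => by rw [Subtype.ext_iff])
      rw [h]
      exact ⟨(Finite.equivFin _).symm⟩
    let E : ∀ d : D, Fin (α d.1) ≃ {i // r' i = d} := fun d => (hfib d).some
    let e : (Σ d : D, Fin (α d.1)) ≃ ι :=
      (Equiv.sigmaCongrRight E).trans (Equiv.sigmaFiberEquiv r')
    have he : ∀ s, r' (e s) = s.1 := fun s => (E s.1 s.2).2
    let p : D → ι := fun d => (E d ⟨0, Nat.pos_of_ne_zero d.2⟩).1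
    have hp : ∀ d, r' (p d) = d := fun d => (E d ⟨0, Nat.pos_of_ne_zero d.2⟩).2
    let Y : D → Repn k Q := fun d => Xi (p d)
    have hdv : ∀ i, DynkinAut.dv (Xi i) = natc (r' i).1 := fun i => by
      unfold DynkinAut.dv
      rw [(hX i).2.2]
    have hdY : ∀ d, DynkinAut.dv (Y d) = natc d.1 := fun d => by
      show DynkinAut.dv (Xi (p d)) = _
      rw [hdv, hp]
    have iY : ∀ d, (Y d).Indec := fun d => (hX _).1
    have fY : ∀ d, (Y d).FinDim := fun d => (hX _).2.1
    have tY : ∀ d, titsZ Q (DynkinAut.dv (Y d)) = 1 := fun d => by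
      rw [hdY]; exact (hαroot d.1 d.2).2
    have hiso : ∀ s, Nonempty (Repn.Iso (Xi (e s)) (Y s.1)) := fun s =>
      DynkinAut.iso_of_dimv hpos (hX _).1 (hX _).2.1 (iY _) (fY _)
        (by rw [hdv, hdY, he]) (by rw [hdv, he]; exact (hαroot _ s.1.2).2)
    obtain ⟨G⟩ := DynkinAut.iso_dsumFam e Xi (fun s => Y s.1) (fun s => (hiso s).some) g
    have key := DynkinAut.aut_count hpos (fun d : D => α d.1) Y iY fY tY (by
      intro d d' hne h
      rw [hdY, hdY] at h
      apply hne
      refine Subtype.ext (funext fun v => ?_)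
      have := congrFun h v
      unfold natc at this
      exact_mod_cast this)
    have hq : 0 < Nat.card k := Nat.card_pos
    have hH : ∀ d d', homDim (Y d) (Y d') = (eulerZ Q (natc d.1) (natc d'.1)).toNat :=
      fun d d' => by
        rw [DynkinAut.homDim_formula hpos (iY d) (fY d) (iY d') (fY d'), hdY, hdY]
    rw [DynkinAut.sum_split (fun d : D => α d.1) (fun d d' => homDim (Y d) (Y d')) (fun d => by
      rw [hH]
      have := (hαroot d.1 d.2).2
      unfold titsZ at this
      rw [this]; rfl), pow_add, mul_left_comm, mul_comm] at key
    have key2 := Nat.eq_of_mul_eq_mul_left (Nat.pow_pos hq) key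
    have hN : (∑ s : (Σ d : D, Fin (α d.1)), ∑ t : (Σ d : D, Fin (α d.1)),
        if s.1 = t.1 then 0 else homDim (Y t.1) (Y s.1)) =
        DynkinAut.expo Q α (fun d : D => d.1) := by
      unfold DynkinAut.expo
      refine Finset.sum_congr rfl fun s _ => Finset.sum_congr rfl fun t _ => ?_
      rw [hH]
      congr
    rw [DynkinAut.autCard_congr G, key2, hN, Nat.cast_mul, Nat.cast_prod,
      Finset.prod_congr rfl (fun d _ => DynkinAut.natCard_sub_int _ _ hq)]
    rw [Polynomial.eval_mul, Polynomial.eval_prod, Nat.card_eq_fintype_card]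
    simp only [Polynomial.eval_prod, Polynomial.eval_sub, Polynomial.eval_pow, Polynomial.eval_X,
      Nat.cast_pow]
    ring
end

section
/- Given a Segre symbol σ, there exist a monic polynomial a_σ ∈ ℤ[T] and a polynomial n_σ ∈ ℚ[T] such that for every finite field k with q elements: |Aut(M)| = a_σ(q) for every module M in the Segre class S(σ,k), and |S(σ,k)| = n_σ(q). -/
open Polynomial

/-- The `k[t]`-module `⊕_i M(λ_i, p_i)`, where `M(λ,p) = ⊕_{c ∈ λ} k[t]/(p^c)`,
built from a list of pairs (partition, polynomial). -/
abbrev segreModule (k : Type) [Field k] (L : List (List ℕ+ × Polynomial k)) : Type :=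
  ∀ i : Fin L.length, ∀ j : Fin (L.get i).1.length,
    Polynomial k ⧸ Ideal.span {((L.get i).2) ^ ((((L.get i).1.get j) : ℕ+) : ℕ)}

/-- `M` belongs to the Segre class `S(σ,k)`, where a Segre symbol `σ` is a multiset of
pairs (partition, degree): `M ≅ ⊕_i M(λ_i,p_i)` for pairwise distinct monic irreducible
polynomials `p_i` with `deg p_i = d_i`, where `σ = {(λ_1,d_1),…,(λ_r,d_r)}`. -/
def InSegreClass (σ : Multiset (Multiset ℕ+ × ℕ)) (k : Type) [Field k]
    (M : Type) [AddCommGroup M] [Module (Polynomial k) M] : Prop :=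
  ∃ L : List (List ℕ+ × Polynomial k),
    (∀ x ∈ L, x.2.Monic ∧ Irreducible x.2) ∧
    (L.map Prod.snd).Nodup ∧
    ((L.map fun x => ((x.1 : Multiset ℕ+), x.2.natDegree) : List _) : Multiset _) = σ ∧
    Nonempty (M ≃ₗ[Polynomial k] segreModule k L)

/-- The members of the Segre class `S(σ,k)`: since the data `{(λ_i,p_i)}` of a module is
unique, isomorphism classes of modules in `S(σ,k)` correspond exactly to multisets of
pairs (partition, monic irreducible polynomial) with pairwise distinct polynomials and
degrees as prescribed by `σ`. -/
def SegreClassType (σ : Multiset (Multiset ℕ+ × ℕ)) (k : Type) [Field k] : Type :=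
  {m : Multiset (Multiset ℕ+ × Polynomial k) //
    (∀ x ∈ m, x.2.Monic ∧ Irreducible x.2) ∧
    (m.map Prod.snd).Nodup ∧
    m.map (fun x => (x.1, x.2.natDegree)) = σ}

/-- A list of data representing the multiset `m`. -/
noncomputable def dataList (k : Type) [Field k]
    (m : Multiset (Multiset ℕ+ × Polynomial k)) : List (List ℕ+ × Polynomial k) :=
  m.toList.map fun x => (x.1.toList, x.2)

/-- A module representing the isomorphism class encoded by the multiset `m`. -/
noncomputable def moduleOfData (k : Type) [Field k]
    (m : Multiset (Multiset ℕ+ × Polynomial k)) : Type :=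
  segreModule k (dataList k m)

noncomputable instance (k : Type) [Field k] (m : Multiset (Multiset ℕ+ × Polynomial k)) :
    AddCommGroup (moduleOfData k m) := by unfold moduleOfData; infer_instance

noncomputable instance (k : Type) [Field k] (m : Multiset (Multiset ℕ+ × Polynomial k)) :
    Module (Polynomial k) (moduleOfData k m) := by unfold moduleOfData; infer_instance


noncomputable def irrCount (k : Type) [Field k] (d : ℕ) : ℕ :=
  Nat.card {p : k[X] // (p.Monic ∧ Irreducible p) ∧ p.natDegree = d}

lemma irr_factors (k : Type) [Field k] [Fintype k] (n : ℕ) (hn : n ≠ 0) :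
    ∃ T : Finset k[X], (∀ p, p ∈ T ↔ (p.Monic ∧ Irreducible p) ∧ p.natDegree ∣ n) ∧
      ∑ p ∈ T, p.natDegree = Fintype.card k ^ n := by
  classical
  set F : k[X] := X ^ (Fintype.card k ^ n) - X with hF
  have hq : 1 < Fintype.card k := Fintype.one_lt_card
  have hF0 : F ≠ 0 := FiniteField.X_pow_card_pow_sub_X_ne_zero _ hn hq
  have hFm : F.Monic := by
    apply monic_X_pow_sub
    rw [degree_X]
    exact_mod_cast Nat.one_lt_pow hn hq
  have hsep : F.Separable := by
    obtain ⟨p, hp⟩ := CharP.exists k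
    refine galois_poly_separable p _ ?_
    rw [← CharP.cast_eq_zero_iff k p]
    simp [hn]
  have hsq := hsep.squarefree
  have hnd := (UniqueFactorizationMonoid.squarefree_iff_nodup_normalizedFactors hF0).1 hsq
  refine ⟨(UniqueFactorizationMonoid.normalizedFactors F).toFinset, ?_, ?_⟩
  · intro p
    rw [Multiset.mem_toFinset, UniqueFactorizationMonoid.mem_normalizedFactors_iff' hF0]
    constructor
    · rintro ⟨h1, h2, h3⟩
      have hm : p.Monic := by rw [← h2]; exact monic_normalize h1.ne_zero
      refine ⟨⟨hm, h1⟩, ?_⟩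
      rw [h1.natDegree_dvd_iff_dvd_X_pow_card_pow_sub_X, Nat.card_eq_fintype_card]
      exact h3
    · rintro ⟨⟨hm, h1⟩, h3⟩
      rw [h1.natDegree_dvd_iff_dvd_X_pow_card_pow_sub_X, Nat.card_eq_fintype_card] at h3
      exact ⟨h1, hm.normalize_eq_self, h3⟩
  · have h1 : (UniqueFactorizationMonoid.normalizedFactors F).prod = F := by
      rw [UniqueFactorizationMonoid.prod_normalizedFactors_eq hF0, hFm.normalize_eq_self]
    have h2 := FiniteField.X_pow_card_pow_sub_X_natDegree_eq k hn hq
    change F.natDegree = _ at h2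
    rw [← h2]
    conv_rhs => rw [← h1]
    rw [natDegree_multiset_prod]
    · rw [Finset.sum, Multiset.toFinset_val, Multiset.dedup_eq_self.2 hnd]
    · exact UniqueFactorizationMonoid.zero_notMem_normalizedFactors F

lemma irr_finite (k : Type) [Field k] [Fintype k] (n : ℕ) (hn : n ≠ 0) :
    Finite {p : k[X] // (p.Monic ∧ Irreducible p) ∧ p.natDegree = n} := by
  obtain ⟨T, hT, -⟩ := irr_factors k n hn
  refine Set.Finite.subset (T.finite_toSet) ?_
  rintro p ⟨h1, h2⟩
  exact (hT p).2 ⟨h1, h2 ▸ dvd_rfl⟩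

lemma irr_sum (k : Type) [Field k] [Fintype k] (n : ℕ) (hn : n ≠ 0) :
    ∑ d ∈ n.divisors, d * irrCount k d = Fintype.card k ^ n := by
  classical
  obtain ⟨T, hT, hs⟩ := irr_factors k n hn
  rw [← hs, ← Finset.sum_fiberwise_of_maps_to (s := T) (t := n.divisors) (g := natDegree)
    (fun p hp => Nat.mem_divisors.2 ⟨((hT p).1 hp).2, hn⟩)]
  refine Finset.sum_congr rfl fun d hd => ?_
  rw [Finset.sum_congr rfl (g := fun _ => d) (by intro x hx; simpa using (Finset.mem_filter.1 hx).2)]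
  rw [Finset.sum_const, smul_eq_mul, mul_comm]
  congr 1
  unfold irrCount
  refine Nat.subtype_card _ ?_
  intro p
  rw [Finset.mem_filter, hT]
  constructor
  · rintro ⟨⟨h1, -⟩, h3⟩
    exact ⟨h1, h3⟩
  · rintro ⟨h1, h3⟩
    exact ⟨⟨h1, h3 ▸ (Nat.mem_divisors.1 hd).1⟩, h3⟩

lemma irr_poly (d : ℕ) : d ≠ 0 → ∃ P : ℚ[X], ∀ (k : Type) [Field k] [Fintype k],
    (irrCount k d : ℚ) = P.eval (Fintype.card k : ℚ) := by
  induction d using Nat.strong_induction_on with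
  | _ d ih =>
    intro hd
    have : ∀ e : ℕ, ∃ P : ℚ[X], e ∈ d.properDivisors → ∀ (k : Type) [Field k] [Fintype k],
        (irrCount k e : ℚ) = P.eval (Fintype.card k : ℚ) := by
      intro e
      by_cases he : e ∈ d.properDivisors
      · obtain ⟨P, hP⟩ := ih e (Nat.mem_properDivisors.1 he).2
          (Nat.pos_of_mem_properDivisors he).ne'
        exact ⟨P, fun _ => hP⟩
      · exact ⟨0, fun h => absurd h he⟩
    choose P hP using this
    refine ⟨C ((d : ℚ)⁻¹) * (X ^ d - ∑ e ∈ d.properDivisors, C (e : ℚ) * P e), ?_⟩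
    intro k _ _
    have h := irr_sum k d hd
    rw [← Nat.cons_self_properDivisors hd, Finset.sum_cons] at h
    have h' : (d : ℚ) * irrCount k d + ∑ e ∈ d.properDivisors, (e : ℚ) * irrCount k e
      = (Fintype.card k : ℚ) ^ d := by exact_mod_cast h
    rw [Finset.sum_congr rfl fun e he => by rw [hP e he k]] at h'
    have hd' : (d : ℚ) ≠ 0 := by exact_mod_cast hd
    simp only [eval_mul, eval_C, eval_sub, eval_pow, eval_X, eval_finsetSum]
    field_simp
    linarith

/-- Type of an entry. -/
noncomputable def entryType (k : Type) [Field k] (x : Multiset ℕ+ × Polynomial k) :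
    Multiset ℕ+ × ℕ := (x.1, x.2.natDegree)

open Classical in
noncomputable def segreStep (σ : Multiset (Multiset ℕ+ × ℕ)) (x : Multiset ℕ+ × ℕ)
    (k : Type) [Field k] :
    (Σ m : SegreClassType (x ::ₘ σ) k,
      {y : Multiset ℕ+ × Polynomial k // y ∈ m.1 ∧ entryType k y = x}) ≃
    (Σ m : SegreClassType σ k,
      {p : Polynomial k // ((p.Monic ∧ Irreducible p) ∧ p.natDegree = x.2) ∧
        p ∉ m.1.map Prod.snd}) where
  toFun z := by
    refine ⟨⟨z.1.1.erase z.2.1, ?_, ?_, ?_⟩, ⟨z.2.1.2, ⟨z.1.2.1 _ z.2.2.1, ?_⟩, ?_⟩⟩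
    · intro y hy
      exact z.1.2.1 y (Multiset.mem_of_mem_erase hy)
    · exact Multiset.nodup_of_le (Multiset.map_le_map (Multiset.erase_le _ _)) z.1.2.2.1
    · have h := z.1.2.2.2
      rw [← Multiset.cons_erase z.2.2.1, Multiset.map_cons] at h
      have h2 : (z.2.1.1, z.2.1.2.natDegree) = x := z.2.2.2
      rw [h2] at h
      exact (Multiset.cons_inj_right _).1 h
    · exact congrArg Prod.snd (show (z.2.1.1, z.2.1.2.natDegree) = x from z.2.2.2)
    · have h := z.1.2.2.1
      rw [← Multiset.cons_erase z.2.2.1, Multiset.map_cons] at h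
      exact (Multiset.nodup_cons.1 h).1
  invFun z := by
    refine ⟨⟨(x.1, z.2.1) ::ₘ z.1.1, ?_, ?_, ?_⟩, ⟨(x.1, z.2.1), ?_, ?_⟩⟩
    · intro y hy
      rcases Multiset.mem_cons.1 hy with rfl | hy
      · exact z.2.2.1.1
      · exact z.1.2.1 y hy
    · rw [Multiset.map_cons, Multiset.nodup_cons]
      exact ⟨z.2.2.2, z.1.2.2.1⟩
    · rw [Multiset.map_cons, z.1.2.2.2]
      simp only [z.2.2.1.2]
    · exact Multiset.mem_cons_self _ _
    · simp only [entryType, z.2.2.1.2]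
  left_inv := by
    rintro ⟨⟨m, hm⟩, ⟨⟨l, p⟩, hy⟩⟩
    have h2 : (l, p.natDegree) = x := hy.2
    have h1 : x.1 = l := by rw [← h2]
    apply Sigma.subtype_ext
    · apply Subtype.ext
      simp only [h1]
      exact Multiset.cons_erase hy.1
    · simp only [h1]
  right_inv := by
    rintro ⟨⟨m, hm⟩, ⟨p, hy⟩⟩
    apply Sigma.subtype_ext
    · apply Subtype.ext
      exact Multiset.erase_cons_head _ _
    · rfl

open Classical in
lemma segre_fiber1 (σ : Multiset (Multiset ℕ+ × ℕ)) (x : Multiset ℕ+ × ℕ)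
    (k : Type) [Field k] (m : SegreClassType (x ::ₘ σ) k) :
    Nat.card {y : Multiset ℕ+ × Polynomial k // y ∈ m.1 ∧ entryType k y = x}
      = σ.count x + 1 := by
  have hnd : m.1.Nodup := Multiset.Nodup.of_map _ m.2.2.1
  have h := m.2.2.2
  have h2 : (m.1.map (entryType k)).count x = σ.count x + 1 := by
    have : m.1.map (entryType k) = x ::ₘ σ := h
    rw [this, Multiset.count_cons_self]
  rw [← h2, Multiset.count_map]
  rw [Nat.subtype_card ((m.1.filter (fun a => x = entryType k a)).toFinset)]
  · rw [Multiset.toFinset_card_of_nodup (hnd.filter _)]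
  · intro y
    simp [eq_comm]

open Classical in
lemma segre_fiber2 (σ : Multiset (Multiset ℕ+ × ℕ)) (d : ℕ) (hd : d ≠ 0)
    (k : Type) [Field k] [Fintype k] (m : SegreClassType σ k) :
    Nat.card {p : Polynomial k // ((p.Monic ∧ Irreducible p) ∧ p.natDegree = d) ∧
        p ∉ m.1.map Prod.snd} + (σ.filter (fun a => a.2 = d)).card = irrCount k d := by
  have hfin := irr_finite k d hd
  have hfin' : {p : Polynomial k | (p.Monic ∧ Irreducible p) ∧ p.natDegree = d}.Finite := hfin
  set U := hfin'.toFinset with hU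
  have hUm : ∀ p, p ∈ U ↔ (p.Monic ∧ Irreducible p) ∧ p.natDegree = d := by
    intro p; simp [hU]
  set W := ((m.1.map Prod.snd).filter (fun p => p.natDegree = d)).toFinset with hW
  have hWU : W ⊆ U := by
    intro p hp
    rw [hW, Multiset.mem_toFinset, Multiset.mem_filter] at hp
    obtain ⟨hp1, hp2⟩ := hp
    obtain ⟨y, hy, rfl⟩ := Multiset.mem_map.1 hp1
    exact (hUm _).2 ⟨m.2.1 y hy, hp2⟩
  have hWc : W.card = (σ.filter (fun a => a.2 = d)).card := by
    rw [hW, Multiset.toFinset_card_of_nodup (m.2.2.1.filter _)]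
    conv_rhs => rw [← m.2.2.2]
    rw [Multiset.filter_map, Multiset.filter_map, Multiset.card_map, Multiset.card_map]
    rfl
  have h1 : irrCount k d = U.card := Nat.subtype_card _ hUm
  rw [h1, ← hWc, ← Finset.card_sdiff_add_card_eq_card hWU]
  congr 1
  refine Nat.subtype_card _ ?_
  intro p
  rw [Finset.mem_sdiff, hUm, hW, Multiset.mem_toFinset, Multiset.mem_filter]
  tauto

lemma segre_count (σ : Multiset (Multiset ℕ+ × ℕ)) :
    (∀ p ∈ σ, 0 < p.2) → ∃ n : Polynomial ℚ, ∀ (k : Type) [Field k] [Fintype k],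
      Finite (SegreClassType σ k) ∧
      (Nat.card (SegreClassType σ k) : ℚ) = n.eval ((Fintype.card k : ℚ)) := by
  classical
  induction σ using Multiset.induction_on with
  | empty =>
    intro _
    refine ⟨1, fun k _ _ => ?_⟩
    have : Unique (SegreClassType 0 k) :=
      { default := ⟨0, by simp⟩
        uniq := fun m => Subtype.ext (Multiset.map_eq_zero.1 m.2.2.2) }
    exact ⟨inferInstance, by simp⟩
  | cons x σ ih =>
    intro h
    obtain ⟨n, hn⟩ := ih fun p hp => h p (Multiset.mem_cons_of_mem hp)
    have hx : x.2 ≠ 0 := (h x (Multiset.mem_cons_self _ _)).ne'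
    obtain ⟨P, hP⟩ := irr_poly x.2 hx
    refine ⟨C (((σ.count x + 1 : ℕ) : ℚ)⁻¹) *
      (n * (P - C (((σ.filter (fun a => a.2 = x.2)).card : ℕ) : ℚ))), fun k _ _ => ?_⟩
    obtain ⟨hf, hc⟩ := hn k
    have hfin := irr_finite k x.2 hx
    have f2 : ∀ m : SegreClassType σ k, Finite {p : Polynomial k //
        ((p.Monic ∧ Irreducible p) ∧ p.natDegree = x.2) ∧ p ∉ m.1.map Prod.snd} := fun m =>
      Finite.of_injective
        (fun p => (⟨p.1, p.2.1⟩ : {p : k[X] // (p.Monic ∧ Irreducible p) ∧ p.natDegree = x.2}))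
        (fun a b hab => Subtype.ext (congrArg (fun z => z.1) hab))
    have e := segreStep σ x k
    have fS := Finite.of_equiv _ e.symm
    have fib1 := segre_fiber1 σ x k
    have f3 : Finite (SegreClassType (x ::ₘ σ) k) := by
      refine Finite.of_surjective (fun z : (Σ m : SegreClassType (x ::ₘ σ) k,
        {y : Multiset ℕ+ × Polynomial k // y ∈ m.1 ∧ entryType k y = x}) => z.1) ?_
      intro m
      have h1 := fib1 m
      have : 0 < Nat.card {y : Multiset ℕ+ × Polynomial k // y ∈ m.1 ∧ entryType k y = x} := by
        omega
      obtain ⟨y⟩ := (Nat.card_pos_iff.1 this).1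
      exact ⟨⟨m, y⟩, rfl⟩
    refine ⟨f3, ?_⟩
    have f1 : ∀ m : SegreClassType (x ::ₘ σ) k,
        Finite {y : Multiset ℕ+ × Polynomial k // y ∈ m.1 ∧ entryType k y = x} := fun m =>
      Nat.finite_of_card_ne_zero (by rw [fib1 m]; omega)
    have hcard := Nat.card_congr e
    have : Fintype (SegreClassType (x ::ₘ σ) k) := Fintype.ofFinite _
    have : Fintype (SegreClassType σ k) := Fintype.ofFinite _
    rw [Nat.card_sigma, Nat.card_sigma] at hcard
    have hq := congrArg (Nat.cast : ℕ → ℚ) hcard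
    rw [Nat.cast_sum, Nat.cast_sum] at hq
    rw [Finset.sum_congr rfl fun m _ => by rw [fib1 m]] at hq
    have fib2 : ∀ m : SegreClassType σ k, (Nat.card {p : Polynomial k //
        ((p.Monic ∧ Irreducible p) ∧ p.natDegree = x.2) ∧ p ∉ m.1.map Prod.snd} : ℚ)
        = P.eval ((Fintype.card k : ℚ)) - (σ.filter (fun a => a.2 = x.2)).card := by
      intro m
      rw [← hP k, ← segre_fiber2 σ x.2 hx k m]
      push_cast
      ring
    rw [Finset.sum_congr rfl fun m _ => fib2 m] at hq
    rw [Finset.sum_const, Finset.sum_const, nsmul_eq_mul, nsmul_eq_mul, Finset.card_univ,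
      Finset.card_univ, ← Nat.card_eq_fintype_card, ← Nat.card_eq_fintype_card, hc] at hq
    have hne : ((σ.count x + 1 : ℕ) : ℚ) ≠ 0 := by positivity
    simp only [eval_mul, eval_C, eval_sub]
    rw [← hq]
    field_simp

section AutCount

variable {R : Type} [CommRing R]

lemma tors_card_quot [IsDomain R] (p : R) (hp : p ≠ 0) (Q : ℕ)
    (hQ : ∀ c : ℕ, Nat.card (R ⧸ Ideal.span {p ^ c}) = Q ^ c) (a c : ℕ) :
    Nat.card {x : R ⧸ Ideal.span {p ^ c} // p ^ a • x = 0} = Q ^ (min a c) := by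
  rcases le_total c a with h | h
  · rw [min_eq_right h, ← hQ c]
    refine Nat.card_congr (Equiv.subtypeUnivEquiv ?_)
    intro x
    obtain ⟨r, rfl⟩ := Ideal.Quotient.mk_surjective x
    rw [← Ideal.Quotient.mk_eq_mk, ← Submodule.Quotient.mk_smul, Submodule.Quotient.mk_eq_zero,
      Ideal.mem_span_singleton]
    exact Dvd.dvd.mul_right (pow_dvd_pow p h) r
  · rw [min_eq_left h, ← hQ a]
    have key : p ^ c = p ^ (c - a) * p ^ a := by rw [← pow_add]; congr 1; omega
    let g : R →ₗ[R] (R ⧸ Ideal.span {p ^ c}) :=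
      (p ^ (c - a)) • (Submodule.mkQ (Ideal.span {p ^ c}))
    have hg : ∀ r, g r = 0 ↔ r ∈ Ideal.span {p ^ a} := by
      intro r
      have : g r = Submodule.Quotient.mk (p ^ (c - a) • r) := rfl
      rw [this, Submodule.Quotient.mk_eq_zero, Ideal.mem_span_singleton, Ideal.mem_span_singleton,
        key, smul_eq_mul, mul_dvd_mul_iff_left (pow_ne_zero _ hp)]
    let G : (R ⧸ Ideal.span {p ^ a}) →ₗ[R] (R ⧸ Ideal.span {p ^ c}) :=
      Submodule.liftQ _ g (fun r hr => (hg r).2 hr)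
    have hGm : ∀ r : R, G (Submodule.Quotient.mk r) = g r := fun r => rfl
    symm
    refine Nat.card_congr (Equiv.ofBijective (fun x => ⟨G x, ?_⟩) ⟨?_, ?_⟩)
    · obtain ⟨r, rfl⟩ := Submodule.Quotient.mk_surjective _ x
      rw [hGm, ← map_smul, hg, Ideal.mem_span_singleton]
      exact Dvd.intro _ rfl
    · intro x y hxy
      have hxy' : G x = G y := congrArg Subtype.val hxy
      rw [← sub_eq_zero, ← map_sub] at hxy'
      rw [← sub_eq_zero]
      obtain ⟨r, hr⟩ := Submodule.Quotient.mk_surjective _ (x - y)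
      rw [← hr] at hxy' ⊢
      rw [hGm, hg] at hxy'
      exact (Submodule.Quotient.mk_eq_zero _).2 hxy'
    · rintro ⟨y, hy⟩
      obtain ⟨r, rfl⟩ := Submodule.Quotient.mk_surjective _ y
      rw [← Submodule.Quotient.mk_smul, Submodule.Quotient.mk_eq_zero, Ideal.mem_span_singleton,
        key, smul_eq_mul, mul_comm (p ^ (c - a)), mul_dvd_mul_iff_left (pow_ne_zero _ hp)] at hy
      obtain ⟨s, rfl⟩ := hy
      exact ⟨Submodule.Quotient.mk s, rfl⟩

/-- Injective linear maps. -/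
abbrev InjHom (R : Type) [CommRing R] (P M : Type) [AddCommGroup P] [Module R P]
    [AddCommGroup M] [Module R M] : Type := {f : P →ₗ[R] M // Function.Injective f}

/-- Extensions of an injection. -/
lemma inj_prod_iff [IsDomain R] [IsPrincipalIdealRing R] (p : R) (hp : Irreducible p) (c : ℕ)
    (hc : 0 < c) {P M : Type} [AddCommGroup P] [Module R P] [AddCommGroup M] [Module R M]
    (g : (R ⧸ Ideal.span {p ^ c}) →ₗ[R] M) (f : P →ₗ[R] M) (hf : Function.Injective f) :
    Function.Injective (g.coprod f) ↔
      p ^ (c - 1) • g (Submodule.Quotient.mk 1) ∉ LinearMap.range f := by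
  have hgm : ∀ r : R, g (Submodule.Quotient.mk r) = r • g (Submodule.Quotient.mk 1) := by
    intro r
    rw [← map_smul, ← Submodule.Quotient.mk_smul, smul_eq_mul, mul_one]
  have hkill : p ^ c • g (Submodule.Quotient.mk 1) = 0 := by
    rw [← hgm]
    convert map_zero g
    rw [Submodule.Quotient.mk_eq_zero]
    exact Ideal.mem_span_singleton_self _
  constructor
  · rintro h ⟨y, hy⟩
    have h1 : (g.coprod f) (Submodule.Quotient.mk (p ^ (c - 1)), -y) = 0 := by
      rw [LinearMap.coprod_apply, hgm, map_neg, hy]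
      simp
    have h2 := (injective_iff_map_eq_zero _).1 h _ h1
    have h3 := (Submodule.Quotient.mk_eq_zero _).1 (Prod.ext_iff.1 h2).1
    rw [Ideal.mem_span_singleton, pow_dvd_pow_iff hp.ne_zero hp.not_isUnit] at h3
    omega
  · intro h
    rw [injective_iff_map_eq_zero]
    rintro ⟨x, y⟩ hxy
    obtain ⟨r, rfl⟩ := Submodule.Quotient.mk_surjective _ x
    rw [LinearMap.coprod_apply, hgm] at hxy
    simp only at hxy
    have hr : p ^ c ∣ r := by
      by_contra hr
      have hr0 : r ≠ 0 := by rintro rfl; exact hr (dvd_zero _)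
      obtain ⟨e, u, hu, rfl⟩ := WfDvdMonoid.max_power_factor hr0 hp
      have hec : e < c := by
        by_contra hec
        exact hr (Dvd.dvd.mul_right (pow_dvd_pow p (by omega)) u)
      have hcop : IsCoprime u (p ^ c) :=
        (((hp.coprime_iff_not_dvd).2 hu).symm).pow_right
      obtain ⟨v, w, hvw⟩ := hcop
      apply h
      refine ⟨-(v * p ^ (c - 1 - e)) • y, ?_⟩
      have h4 : f y = - ((p ^ e * u) • g (Submodule.Quotient.mk 1)) := by
        rw [eq_neg_iff_add_eq_zero, add_comm]; exact hxy
      rw [map_smul, h4, smul_neg, neg_smul, neg_neg, smul_smul]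
      have h5 : v * p ^ (c - 1 - e) * (p ^ e * u) = p ^ (c - 1) - (p ^ (c - 1) * w) * p ^ c := by
        have : p ^ (c - 1) = p ^ (c - 1 - e) * p ^ e := by rw [← pow_add]; congr 1; omega
        rw [this]
        linear_combination (p ^ (c - 1 - e) * p ^ e) * hvw
      rw [h5, sub_smul, mul_smul _ (p ^ c), hkill, smul_zero, sub_zero]
    have hz : (Submodule.Quotient.mk r : R ⧸ Ideal.span {p ^ c}) = 0 :=
      (Submodule.Quotient.mk_eq_zero _).2 (Ideal.mem_span_singleton.2 hr)
    rw [← hgm, hz, map_zero, zero_add] at hxy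
    rw [hz, (injective_iff_map_eq_zero _).1 hf y hxy]
    rfl

/-- Homs out of a cyclic module. -/
def homOfTors (a : R) {M : Type} [AddCommGroup M] [Module R M] (x : M) (hx : a • x = 0) :
    (R ⧸ Ideal.span {a}) →ₗ[R] M :=
  Submodule.liftQ _ (LinearMap.toSpanSingleton R M x) (by
    intro r hr
    obtain ⟨s, rfl⟩ := Ideal.mem_span_singleton.1 hr
    rw [LinearMap.mem_ker, LinearMap.toSpanSingleton_apply, mul_comm, mul_smul, hx, smul_zero])

lemma homOfTors_one (a : R) {M : Type} [AddCommGroup M] [Module R M] (x : M) (hx : a • x = 0) :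
    homOfTors a x hx (Submodule.Quotient.mk 1) = x := by
  change (1 : R) • x = x
  exact one_smul _ _

lemma hom_ext_one (a : R) {M : Type} [AddCommGroup M] [Module R M]
    (g h : (R ⧸ Ideal.span {a}) →ₗ[R] M)
    (hgh : g (Submodule.Quotient.mk 1) = h (Submodule.Quotient.mk 1)) : g = h := by
  ext
  exact hgh

lemma hom_kill_one (a : R) {M : Type} [AddCommGroup M] [Module R M]
    (g : (R ⧸ Ideal.span {a}) →ₗ[R] M) : a • g (Submodule.Quotient.mk 1) = 0 := by
  rw [← map_smul, ← Submodule.Quotient.mk_smul, smul_eq_mul, mul_one]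
  convert map_zero g
  rw [Submodule.Quotient.mk_eq_zero]
  exact Ideal.mem_span_singleton_self _

noncomputable def injProdEquiv [IsDomain R] [IsPrincipalIdealRing R] (p : R) (hp : Irreducible p)
    (c : ℕ) (hc : 0 < c) (P M : Type) [AddCommGroup P] [Module R P] [AddCommGroup M] [Module R M] :
    InjHom R ((R ⧸ Ideal.span {p ^ c}) × P) M ≃
      Σ f : InjHom R P M, {x : M // p ^ c • x = 0 ∧ p ^ (c - 1) • x ∉ LinearMap.range f.1} where
  toFun F := by
    have hfi : Function.Injective (F.1.comp (LinearMap.inr R (R ⧸ Ideal.span {p ^ c}) P)) :=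
      F.2.comp LinearMap.inr_injective
    refine ⟨⟨F.1.comp (LinearMap.inr R _ _), hfi⟩,
      ⟨(F.1.comp (LinearMap.inl R _ _)) (Submodule.Quotient.mk 1), hom_kill_one _ _, ?_⟩⟩
    rw [← inj_prod_iff p hp c hc (F.1.comp (LinearMap.inl R _ _)) _ hfi]
    have : (F.1.comp (LinearMap.inl R _ _)).coprod (F.1.comp (LinearMap.inr R _ _)) = F.1 := by
      ext <;> simp
    rw [this]
    exact F.2
  invFun z := by
    refine ⟨(homOfTors (p ^ c) z.2.1 z.2.2.1).coprod z.1.1, ?_⟩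
    rw [inj_prod_iff p hp c hc _ _ z.1.2, homOfTors_one]
    exact z.2.2.2
  left_inv := by
    rintro ⟨F, hF⟩
    apply Subtype.ext
    apply LinearMap.prod_ext
    · apply hom_ext_one
      rw [LinearMap.coprod_inl]
      exact homOfTors_one _ _ _
    · ext; simp
  right_inv := by
    rintro ⟨⟨f, hf⟩, ⟨x, hx⟩⟩
    apply Sigma.subtype_ext
    · apply Subtype.ext
      ext
      simp
    · simp only [LinearMap.coprod_inl]
      exact homOfTors_one _ _ _

lemma count_bad (p : R) (c : ℕ) (hc : 0 < c) {P M : Type} [AddCommGroup P] [Module R P]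
    [AddCommGroup M] [Module R M]
    (hP : ∀ y : P, p • y = 0 → ∃ z, p ^ (c - 1) • z = y)
    (f : P →ₗ[R] M) (hf : Function.Injective f) :
    Nat.card {x : M // p ^ c • x = 0 ∧ p ^ (c - 1) • x ∈ LinearMap.range f}
      = Nat.card {x : M // p ^ (c - 1) • x = 0} * Nat.card {y : P // p • y = 0} := by
  have hpc : p ^ c = p * p ^ (c - 1) := by rw [← pow_succ']; congr 1; omega
  choose s hs using hP
  rw [← Nat.card_prod]
  symm
  refine Nat.card_congr (Equiv.ofBijective
    (fun z => ⟨z.1.1 + f (s z.2.1 z.2.2), ?_, ?_⟩) ⟨?_, ?_⟩)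
  · rw [smul_add, hpc, mul_smul, z.1.2, smul_zero, zero_add, mul_smul, ← map_smul, hs,
      ← map_smul, z.2.2, map_zero]
  · rw [smul_add, z.1.2, zero_add, ← map_smul, hs]
    exact ⟨_, rfl⟩
  · rintro ⟨⟨x, hx⟩, ⟨y, hy⟩⟩ ⟨⟨x', hx'⟩, ⟨y', hy'⟩⟩ h
    have h1 : x + f (s y hy) = x' + f (s y' hy') := congrArg Subtype.val h
    have h2 := congrArg (fun t => p ^ (c - 1) • t) h1
    simp only [smul_add, hx, hx', zero_add, ← map_smul, hs] at h2
    have h3 := hf h2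
    subst h3
    have h4 := add_right_cancel h1
    subst h4
    rfl
  · rintro ⟨x, hx, ⟨y, hy⟩⟩
    have hy0 : p • y = 0 := by
      apply hf
      rw [map_smul, hy, smul_smul, ← hpc, hx, map_zero]
    refine ⟨⟨⟨x - f (s y hy0), ?_⟩, ⟨y, hy0⟩⟩, ?_⟩
    · rw [smul_sub, ← map_smul, hs, hy, sub_self]
    · apply Subtype.ext
      exact sub_add_cancel _ _

lemma count_inj_step [IsDomain R] [IsPrincipalIdealRing R] (p : R) (hp : Irreducible p)
    (c : ℕ) (hc : 0 < c) (P M : Type) [AddCommGroup P] [Module R P] [AddCommGroup M] [Module R M]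
    [Finite P] [Finite M]
    (hP : ∀ y : P, p • y = 0 → ∃ z, p ^ (c - 1) • z = y) :
    (Nat.card (InjHom R ((R ⧸ Ideal.span {p ^ c}) × P) M) : ℤ) =
      Nat.card (InjHom R P M) * (Nat.card {x : M // p ^ c • x = 0} -
        Nat.card {x : M // p ^ (c - 1) • x = 0} * Nat.card {y : P // p • y = 0}) := by
  have hfin : Finite (P →ₗ[R] M) := Finite.of_injective (fun f => (f : P → M)) DFunLike.coe_injective
  have : Fintype (InjHom R P M) := Fintype.ofFinite _
  rw [Nat.card_congr (injProdEquiv p hp c hc P M), Nat.card_sigma, Nat.cast_sum]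
  rw [Finset.sum_congr rfl (g := fun _ => (Nat.card {x : M // p ^ c • x = 0} -
        Nat.card {x : M // p ^ (c - 1) • x = 0} * Nat.card {y : P // p • y = 0} : ℤ))]
  · rw [Finset.sum_const, nsmul_eq_mul, Finset.card_univ, Nat.card_eq_fintype_card (α := InjHom R P M)]
  · intro f _
    have h1 := count_bad p c hc hP f.1 f.2
    have h2 : Nat.card {x : M // p ^ c • x = 0} =
        Nat.card {x : M // p ^ c • x = 0 ∧ p ^ (c - 1) • x ∈ LinearMap.range f.1} +
        Nat.card {x : M // p ^ c • x = 0 ∧ p ^ (c - 1) • x ∉ LinearMap.range f.1} := by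
      classical
      rw [← Nat.card_sum]
      refine Nat.card_congr ((Equiv.sumCompl
        (fun x : {x : M // p ^ c • x = 0} => p ^ (c - 1) • x.1 ∈ LinearMap.range f.1)).symm.trans ?_)
      exact Equiv.sumCongr (Equiv.subtypeSubtypeEquivSubtypeInter _
          (fun x => p ^ (c - 1) • x ∈ LinearMap.range f.1))
        (Equiv.subtypeSubtypeEquivSubtypeInter _ (fun x => p ^ (c - 1) • x ∉ LinearMap.range f.1))
    rw [h2, h1]
    push_cast
    ring

end AutCount

section PrimModule

variable {R : Type} [CommRing R]

/-- The primary module of a list of exponents. -/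
abbrev primMod (p : R) (l : List ℕ+) : Type :=
  ∀ j : Fin l.length, R ⧸ Ideal.span {p ^ ((l.get j : ℕ+) : ℕ)}

def primCons (p : R) (c : ℕ+) (l : List ℕ+) :
    ((R ⧸ Ideal.span {p ^ (c : ℕ)}) × primMod p l) ≃ₗ[R] primMod p (c :: l) :=
  Fin.consLinearEquiv R (n := l.length)
    (fun j : Fin (l.length + 1) => R ⧸ Ideal.span {p ^ (((c :: l).get j : ℕ+) : ℕ)})

lemma prim_perm (p : R) {l l' : List ℕ+} (h : l.Perm l') :
    Nonempty (primMod p l ≃ₗ[R] primMod p l') := by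
  induction h with
  | nil => exact ⟨LinearEquiv.refl _ _⟩
  | cons x _ ih =>
    obtain ⟨e⟩ := ih
    exact ⟨(primCons p x _).symm ≪≫ₗ (LinearEquiv.prodCongr (LinearEquiv.refl _ _) e) ≪≫ₗ
      primCons p x _⟩
  | swap x y l =>
    refine ⟨(primCons p y _).symm ≪≫ₗ
      (LinearEquiv.prodCongr (LinearEquiv.refl _ _) (primCons p x l).symm) ≪≫ₗ
      (LinearEquiv.prodAssoc R _ _ _).symm ≪≫ₗ
      (LinearEquiv.prodCongr (LinearEquiv.prodComm R _ _) (LinearEquiv.refl _ _)) ≪≫ₗ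
      (LinearEquiv.prodAssoc R _ _ _) ≪≫ₗ
      (LinearEquiv.prodCongr (LinearEquiv.refl _ _) (primCons p y l)) ≪≫ₗ primCons p x _⟩
  | trans _ _ ih1 ih2 =>
    obtain ⟨e⟩ := ih1
    obtain ⟨f⟩ := ih2
    exact ⟨e ≪≫ₗ f⟩

lemma tors_congr (a : R) {A B : Type} [AddCommGroup A] [AddCommGroup B] [Module R A] [Module R B]
    (e : A ≃ₗ[R] B) : Nat.card {x : A // a • x = 0} = Nat.card {x : B // a • x = 0} := by
  refine Nat.card_congr (e.toEquiv.subtypeEquiv ?_)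
  intro x
  change _ ↔ a • e x = 0
  rw [← map_smul, LinearEquiv.map_eq_zero_iff]

lemma tors_prod (a : R) (A B : Type) [AddCommGroup A] [AddCommGroup B] [Module R A] [Module R B] :
    Nat.card {x : A × B // a • x = 0} =
      Nat.card {x : A // a • x = 0} * Nat.card {x : B // a • x = 0} := by
  rw [← Nat.card_prod]
  refine Nat.card_congr ((Equiv.subtypeEquivRight ?_).trans Equiv.subtypeProdEquivProd)
  rintro ⟨x, y⟩
  simp [Prod.ext_iff]

lemma tors_prim [IsDomain R] (p : R) (hp : p ≠ 0) (Q : ℕ)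
    (hQ : ∀ c : ℕ, Nat.card (R ⧸ Ideal.span {p ^ c}) = Q ^ c) (a : ℕ) (l : List ℕ+) :
    Nat.card {x : primMod p l // p ^ a • x = 0} =
      Q ^ (l.map (fun c : ℕ+ => min a (c : ℕ))).sum := by
  induction l with
  | nil =>
    have : Subsingleton (primMod p []) := ⟨fun f g => funext fun j => Fin.elim0 j⟩
    have : Unique {x : primMod p [] // p ^ a • x = 0} :=
      { default := ⟨0, smul_zero _⟩, uniq := fun _ => Subsingleton.elim _ _ }
    simp
  | cons c l ih =>
    rw [← tors_congr _ (primCons p c l), tors_prod, ih, tors_card_quot p hp Q hQ, List.map_cons,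
      List.sum_cons, pow_add]

lemma prim_div [IsDomain R] (p : R) (hp : p ≠ 0) (e : ℕ+) (l : List ℕ+) (hl : ∀ c ∈ l, e ≤ c)
    (y : primMod p l) (hy : p • y = 0) : ∃ z, p ^ ((e : ℕ) - 1) • z = y := by
  have : ∀ j, ∃ z, p ^ ((e : ℕ) - 1) • z = y j := by
    intro j
    have hj : p • y j = 0 := congrFun hy j
    have hej : (e : ℕ) ≤ (l.get j : ℕ+) := hl _ (List.get_mem _ _)
    have he := e.pos
    revert hej hj
    generalize y j = w
    revert w
    generalize l.get j = c
    intro w hw hej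
    obtain ⟨r, rfl⟩ := Submodule.Quotient.mk_surjective _ w
    have key : p ^ (c : ℕ) = p * (p ^ ((e : ℕ) - 1) * p ^ ((c : ℕ) - e)) := by
      rw [← pow_add, ← pow_succ']; congr 1; omega
    rw [← Submodule.Quotient.mk_smul, Submodule.Quotient.mk_eq_zero, Ideal.mem_span_singleton,
      key, smul_eq_mul, mul_dvd_mul_iff_left hp] at hw
    obtain ⟨s, rfl⟩ := hw
    refine ⟨Submodule.Quotient.mk (p ^ ((c : ℕ) - e) * s), ?_⟩
    rw [← Submodule.Quotient.mk_smul, smul_eq_mul, mul_assoc]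
  choose z hz using this
  exact ⟨z, funext hz⟩

/-- Polynomial counting injections. -/
noncomputable def injPoly (m : List ℕ+) : List ℕ+ → ℤ[X]
  | [] => 1
  | c :: l => injPoly m l * (X ^ (m.map (fun b : ℕ+ => min (c : ℕ) (b : ℕ))).sum -
      X ^ ((m.map (fun b : ℕ+ => min ((c : ℕ) - 1) (b : ℕ))).sum + l.length))

lemma sum_min_le (c : ℕ+) (l m : List ℕ+) (h : l.Sublist m) (hl : ∀ b ∈ l, c ≤ b) :
    (m.map (fun b : ℕ+ => min ((c : ℕ) - 1) (b : ℕ))).sum + l.length ≤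
      (m.map (fun b : ℕ+ => min (c : ℕ) (b : ℕ))).sum := by
  have hc := c.pos
  induction h with
  | slnil => simp
  | cons a _ ih =>
    have := ih hl
    simp only [List.map_cons, List.sum_cons]
    omega
  | cons_cons a _ ih =>
    have h1 := ih fun b hb => hl b (List.mem_cons_of_mem _ hb)
    have h2 : (c : ℕ) ≤ a := hl a List.mem_cons_self
    simp only [List.map_cons, List.sum_cons, List.length_cons]
    omega

lemma injPoly_monic (m l : List ℕ+) (h : l.Sublist m) (hs : l.Pairwise (· ≤ ·)) :
    (injPoly m l).Monic := by
  induction l with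
  | nil => exact monic_one
  | cons c l ih =>
    rw [List.pairwise_cons] at hs
    refine (ih ((List.sublist_cons_self c l).trans h) hs.2).mul ?_
    apply monic_X_pow_sub
    rw [degree_X_pow]
    have := sum_min_le c (c :: l) m h (by
      intro b hb
      rcases List.mem_cons.1 hb with rfl | hb
      · exact le_rfl
      · exact hs.1 b hb)
    rw [List.length_cons] at this
    exact_mod_cast (by omega)

lemma inj_congr (A B M : Type) [AddCommGroup A] [AddCommGroup B] [AddCommGroup M]
    [Module R A] [Module R B] [Module R M] (e : A ≃ₗ[R] B) :
    Nat.card (InjHom R A M) = Nat.card (InjHom R B M) := by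
  refine Nat.card_congr ⟨fun f => ⟨f.1.comp e.symm.toLinearMap, f.2.comp e.symm.injective⟩,
    fun f => ⟨f.1.comp e.toLinearMap, f.2.comp e.injective⟩, ?_, ?_⟩
  · intro f; apply Subtype.ext; ext; simp
  · intro f; apply Subtype.ext; ext; simp

lemma inj_count [IsDomain R] [IsPrincipalIdealRing R] (p : R) (hp : Irreducible p) (Q : ℕ)
    (hQ0 : 0 < Q)
    (hQ : ∀ c : ℕ, Nat.card (R ⧸ Ideal.span {p ^ c}) = Q ^ c) (m l : List ℕ+)
    (hs : l.Pairwise (· ≤ ·)) :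
    (Nat.card (InjHom R (primMod p l) (primMod p m)) : ℤ) = (injPoly m l).eval (Q : ℤ) := by
  have hfin : ∀ c : ℕ, Finite (R ⧸ Ideal.span {p ^ c}) := fun c =>
    Nat.finite_of_card_ne_zero (by rw [hQ]; positivity)
  induction l with
  | nil =>
    have hsub : Subsingleton (primMod p []) := ⟨fun f g => funext fun j => Fin.elim0 j⟩
    have : Unique (InjHom R (primMod p []) (primMod p m)) :=
      { default := ⟨0, fun _ _ _ => Subsingleton.elim _ _⟩
        uniq := fun f => Subtype.ext (LinearMap.ext fun x => by
          rw [Subsingleton.elim x 0, map_zero, map_zero]) }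
    simp [injPoly]
  | cons c l ih =>
    rw [List.pairwise_cons] at hs
    have h1 : Nat.card {y : primMod p l // p • y = 0} = Q ^ l.length := by
      have := tors_prim p hp.ne_zero Q hQ 1 l
      rw [pow_one] at this
      rw [this]
      congr 1
      have : ∀ c : ℕ+, min 1 (c : ℕ) = 1 := fun c => min_eq_left c.pos
      simp [this]
    rw [← inj_congr _ _ _ (primCons p c l), count_inj_step p hp c c.pos _ _
      (prim_div p hp.ne_zero c l hs.1), ih hs.2, tors_prim p hp.ne_zero Q hQ,
      tors_prim p hp.ne_zero Q hQ, h1]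
    simp [injPoly, pow_add]

lemma aut_eq_inj (M : Type) [AddCommGroup M] [Module R M] [Finite M] :
    Nat.card (M ≃ₗ[R] M) = Nat.card (InjHom R M M) := by
  refine Nat.card_congr (Equiv.ofBijective (fun e => ⟨e.toLinearMap, e.injective⟩) ⟨?_, ?_⟩)
  · intro e f h
    exact LinearEquiv.toLinearMap_injective (congrArg Subtype.val h)
  · rintro ⟨f, hf⟩
    exact ⟨LinearEquiv.ofBijective f (Finite.injective_iff_bijective.1 hf), rfl⟩

lemma aut_congr (A B : Type) [AddCommGroup A] [AddCommGroup B]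
    [Module R A] [Module R B] (e : A ≃ₗ[R] B) :
    Nat.card (A ≃ₗ[R] A) = Nat.card (B ≃ₗ[R] B) := by
  refine Nat.card_congr ⟨fun f => e.symm ≪≫ₗ f ≪≫ₗ e, fun f => e ≪≫ₗ f ≪≫ₗ e.symm, ?_, ?_⟩
  · intro f; ext; simp
  · intro f; ext; simp

/-- The polynomial of automorphisms. -/
noncomputable def autPoly (s : Multiset ℕ+) : ℤ[X] :=
  injPoly (s.sort (· ≤ ·)) (s.sort (· ≤ ·))

lemma autPoly_monic (s : Multiset ℕ+) : (autPoly s).Monic :=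
  injPoly_monic _ _ (List.Sublist.refl _) (Multiset.pairwise_sort _ _)

lemma aut_prim [IsDomain R] [IsPrincipalIdealRing R] (p : R) (hp : Irreducible p) (Q : ℕ)
    (hQ0 : 0 < Q)
    (hQ : ∀ c : ℕ, Nat.card (R ⧸ Ideal.span {p ^ c}) = Q ^ c) (l : List ℕ+) :
    (Nat.card (primMod p l ≃ₗ[R] primMod p l) : ℤ) = (autPoly (l : Multiset ℕ+)).eval (Q : ℤ) := by
  have hfin : ∀ c : ℕ, Finite (R ⧸ Ideal.span {p ^ c}) := fun c =>
    Nat.finite_of_card_ne_zero (by rw [hQ]; positivity)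
  have hperm : l.Perm ((l : Multiset ℕ+).sort (· ≤ ·)) := by
    rw [← Multiset.coe_eq_coe, Multiset.sort_eq]
  obtain ⟨e⟩ := prim_perm p hperm
  rw [aut_congr _ _ e, aut_eq_inj]
  exact inj_count p hp Q hQ0 hQ _ _ (Multiset.pairwise_sort _ _)

lemma aut_prod (A B : Type) [AddCommGroup A] [AddCommGroup B]
    [Module R A] [Module R B] (h1 : ∀ f : A →ₗ[R] B, f = 0) (h2 : ∀ f : B →ₗ[R] A, f = 0) :
    Nat.card ((A × B) ≃ₗ[R] (A × B)) = Nat.card (A ≃ₗ[R] A) * Nat.card (B ≃ₗ[R] B) := by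
  rw [← Nat.card_prod]
  symm
  refine Nat.card_congr (Equiv.ofBijective (fun e => LinearEquiv.prodCongr e.1 e.2) ⟨?_, ?_⟩)
  · rintro ⟨e, f⟩ ⟨e', f'⟩ h
    have h' : ∀ x y, (e x, f y) = (e' x, f' y) := fun x y => LinearEquiv.congr_fun h (x, y)
    refine Prod.ext (LinearEquiv.ext fun x => (Prod.ext_iff.1 (h' x 0)).1)
      (LinearEquiv.ext fun y => (Prod.ext_iff.1 (h' 0 y)).2)
  · intro F
    have key : ∀ G : (A × B) ≃ₗ[R] (A × B), (∀ x, (G (x, 0)).2 = 0) ∧ (∀ y, (G (0, y)).1 = 0) := by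
      intro G
      constructor
      · intro x
        exact LinearMap.congr_fun (h1 ((LinearMap.snd R A B).comp
          (G.toLinearMap.comp (LinearMap.inl R A B)))) x
      · intro y
        exact LinearMap.congr_fun (h2 ((LinearMap.fst R A B).comp
          (G.toLinearMap.comp (LinearMap.inr R A B)))) y
    have kA : ∀ (G : (A × B) ≃ₗ[R] (A × B)) x, ((G (x, 0)).1, (0 : B)) = G (x, 0) := fun G x =>
      Prod.ext rfl ((key G).1 x).symm
    have kB : ∀ (G : (A × B) ≃ₗ[R] (A × B)) y, ((0 : A), (G (0, y)).2) = G (0, y) := fun G y =>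
      Prod.ext ((key G).2 y).symm rfl
    let eA : A ≃ₗ[R] A := LinearEquiv.ofLinearMap
      ((LinearMap.fst R A B).comp (F.toLinearMap.comp (LinearMap.inl R A B)))
      ((LinearMap.fst R A B).comp (F.symm.toLinearMap.comp (LinearMap.inl R A B)))
      (LinearMap.ext fun x => by simp [kA]) (LinearMap.ext fun x => by simp [kA])
    let eB : B ≃ₗ[R] B := LinearEquiv.ofLinearMap
      ((LinearMap.snd R A B).comp (F.toLinearMap.comp (LinearMap.inr R A B)))
      ((LinearMap.snd R A B).comp (F.symm.toLinearMap.comp (LinearMap.inr R A B)))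
      (LinearMap.ext fun x => by simp [kB]) (LinearMap.ext fun x => by simp [kB])
    refine ⟨(eA, eB), LinearEquiv.ext ?_⟩
    rintro ⟨x, y⟩
    have hxy : ((x, y) : A × B) = (x, 0) + (0, y) := by simp
    rw [hxy, map_add, map_add]
    have a1 : (LinearEquiv.prodCongr eA eB) (x, 0) = ((F (x, 0)).1, 0) := by
      change (eA x, eB 0) = _
      rw [map_zero]; rfl
    have a2 : (LinearEquiv.prodCongr eA eB) (0, y) = (0, (F (0, y)).2) := by
      change (eA 0, eB y) = _
      rw [map_zero]; rfl
    rw [a1, a2, kA, kB]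

lemma hom_zero_of_coprime (A B : Type) [AddCommGroup A] [AddCommGroup B]
    [Module R A] [Module R B] (a b : R) (h : IsCoprime a b) (ha : ∀ x : A, a • x = 0)
    (hb : ∀ x : B, b • x = 0) (f : A →ₗ[R] B) : f = 0 := by
  obtain ⟨u, v, huv⟩ := h
  ext x
  have h1 : a • f x = 0 := by rw [← map_smul, ha, map_zero]
  rw [← one_smul R (f x), ← huv, add_smul, mul_smul, mul_smul, h1, hb]
  simp

lemma prim_kill (p : R) (l : List ℕ+) : ∃ N : ℕ, ∀ x : primMod p l, p ^ N • x = 0 := by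
  refine ⟨∑ j : Fin l.length, ((l.get j : ℕ+) : ℕ), fun x => funext fun j => ?_⟩
  change p ^ (∑ j : Fin l.length, ((l.get j : ℕ+) : ℕ)) • x j = 0
  obtain ⟨r, hr⟩ := Submodule.Quotient.mk_surjective _ (x j)
  rw [← hr, ← Submodule.Quotient.mk_smul, Submodule.Quotient.mk_eq_zero,
      Ideal.mem_span_singleton]
  exact Dvd.dvd.mul_right (pow_dvd_pow p
    (Finset.single_le_sum (f := fun j => ((l.get j : ℕ+) : ℕ)) (fun _ _ => Nat.zero_le _)
      (Finset.mem_univ j))) r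

end PrimModule

section SegreAut

variable (k : Type) [Field k]

noncomputable def segreCons (x : List ℕ+ × k[X]) (L : List (List ℕ+ × k[X])) :
    (primMod x.2 x.1 × segreModule k L) ≃ₗ[k[X]] segreModule k (x :: L) :=
  Fin.consLinearEquiv k[X] (n := L.length)
    (fun i : Fin (L.length + 1) => primMod ((x :: L).get i).2 ((x :: L).get i).1)

lemma segre_kill (q : k[X]) (hq : q.Monic ∧ Irreducible q) (L : List (List ℕ+ × k[X]))
    (hL : ∀ x ∈ L, x.2.Monic ∧ Irreducible x.2) (hn : q ∉ L.map Prod.snd) :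
    ∃ b : k[X], IsCoprime q b ∧ ∀ y : segreModule k L, b • y = 0 := by
  induction L with
  | nil =>
    exact ⟨1, isCoprime_one_right, fun y => funext fun j => Fin.elim0 j⟩
  | cons x L ih =>
    rw [List.map_cons, List.mem_cons, not_or] at hn
    obtain ⟨b, hb, hb'⟩ := ih (fun y hy => hL y (List.mem_cons_of_mem _ hy)) hn.2
    obtain ⟨N, hN⟩ := prim_kill x.2 x.1
    have hx := hL x List.mem_cons_self
    have hc : IsCoprime q x.2 := by
      rw [hq.2.coprime_iff_not_dvd]
      intro hd
      exact hn.1 (eq_of_monic_of_associated hq.1 hx.1 (hq.2.associated_of_dvd hx.2 hd))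
    refine ⟨x.2 ^ N * b, (hc.pow_right).mul_right hb, fun y => ?_⟩
    obtain ⟨⟨u, v⟩, rfl⟩ := (segreCons k x L).surjective y
    rw [← map_smul]
    convert map_zero (segreCons k x L)
    refine Prod.ext ?_ ?_
    · change (x.2 ^ N * b) • u = 0
      rw [mul_comm, mul_smul, hN, smul_zero]
    · change (x.2 ^ N * b) • v = 0
      rw [mul_smul, hb', smul_zero]

lemma card_quot [Fintype k] (p : k[X]) (hp : p.Monic) (c : ℕ) :
    Nat.card (k[X] ⧸ Ideal.span {p ^ c}) = (Fintype.card k ^ p.natDegree) ^ c := by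
  have : Module.Finite k (k[X] ⧸ Ideal.span {p ^ c}) := (hp.pow c).finite_quotient
  rw [Module.natCard_eq_pow_finrank (K := k), finrank_quotient_span_eq_natDegree,
    natDegree_pow, Nat.card_eq_fintype_card, ← pow_mul, mul_comm]

lemma segre_aut [Fintype k] (L : List (List ℕ+ × k[X]))
    (hL : ∀ x ∈ L, x.2.Monic ∧ Irreducible x.2) (hn : (L.map Prod.snd).Nodup) :
    (Nat.card (segreModule k L ≃ₗ[k[X]] segreModule k L) : ℤ) =
      (L.map fun x => (expand ℤ x.2.natDegree
        (autPoly (x.1 : Multiset ℕ+))).eval (Fintype.card k : ℤ)).prod := by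
  induction L with
  | nil =>
    have hsub : Subsingleton (segreModule k []) := ⟨fun f g => funext fun j => Fin.elim0 j⟩
    have : Unique (segreModule k [] ≃ₗ[k[X]] segreModule k []) :=
      { default := LinearEquiv.refl _ _
        uniq := fun f => LinearEquiv.ext fun x => Subsingleton.elim _ _ }
    simp
  | cons x L ih =>
    rw [List.map_cons, List.nodup_cons] at hn
    have hx := hL x List.mem_cons_self
    have hL' : ∀ y ∈ L, y.2.Monic ∧ Irreducible y.2 := fun y hy => hL y (List.mem_cons_of_mem _ hy)
    obtain ⟨b, hb, hb'⟩ := segre_kill k x.2 hx L hL' hn.1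
    obtain ⟨N, hN⟩ := prim_kill x.2 x.1
    have hcop : IsCoprime (x.2 ^ N) b := hb.pow_left
    rw [← aut_congr _ _ (segreCons k x L), aut_prod _ _
      (hom_zero_of_coprime _ _ _ _ hcop hN hb')
      (hom_zero_of_coprime _ _ _ _ hcop.symm hb' hN), Nat.cast_mul, ih hL' hn.2,
      aut_prim x.2 hx.2 (Fintype.card k ^ x.2.natDegree) (pow_pos Fintype.card_pos _)
        (card_quot k x.2 hx.1)]
    simp [expand_eval]

end SegreAut

/-- For every Segre symbol `σ` there are a monic `a_σ ∈ ℤ[T]` and `n_σ ∈ ℚ[T]` such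
that, for every finite field `k` with `q` elements, `|Aut(M)| = a_σ(q)` for every
module `M ∈ S(σ,k)`, and `|S(σ,k)| = n_σ(q)`. -/
theorem segre_aut_and_count_polynomials (σ : Multiset (Multiset ℕ+ × ℕ))
    (hσ : ∀ p ∈ σ, p.1 ≠ 0 ∧ 0 < p.2) :
    ∃ a : Polynomial ℤ, a.Monic ∧ ∃ n : Polynomial ℚ,
      ∀ (k : Type) [Field k] [Fintype k],
        (∀ (M : Type) [AddCommGroup M] [Module (Polynomial k) M],
          InSegreClass σ k M →
          (Nat.card (M ≃ₗ[Polynomial k] M) : ℤ) = a.eval ((Fintype.card k : ℤ))) ∧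
        (Nat.card (SegreClassType σ k) : ℚ) = n.eval ((Fintype.card k : ℚ)) := by
  classical
  obtain ⟨n, hn⟩ := segre_count σ fun p hp => (hσ p hp).2
  refine ⟨(σ.map fun x => expand ℤ x.2 (autPoly x.1)).prod, ?_, n, ?_⟩
  · apply monic_multiset_prod_of_monic
    intro x hx
    exact (autPoly_monic x.1).expand (hσ x hx).2
  · intro k _ _
    refine ⟨?_, (hn k).2⟩
    rintro M _ _ ⟨L, hL, hnd, hLσ, ⟨e⟩⟩
    rw [aut_congr _ _ e, segre_aut k L hL hnd, ← hLσ, eval_multiset_prod]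
    simp [Function.comp_def]
end
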